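/- Let σ ≤ 0, d > 0, and θ be fixed real numbers, and fix constants C_2 > C_1 > 1. For all positive integers M, N with C_1·N ≤ M ≤ C_2·N and all real u ∈ [1, N]: |Σ_{m=1}^M e^{2πi F_m(u)}/m^{1−σ}| ≤ C·(log(u+1))^{2/3} if σ = 0, and |Σ_{m=1}^M e^{2πi F_m(u)}/m^{1−σ}| ≤ C if σ < 0, where C depends only on σ, d, θ, C_1, C_2. -/

import Mathlib

/-- `Fm d θ m u = d·u·log(e·m/(d·u)) + θ·u`. -/
noncomputable def Fm (d θ : ℝ) (m : ℕ) (u : ℝ) : ℝ :=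
  d * u * Real.log (Real.exp 1 * m / (d * u)) + θ * u


namespace VK

lemma esymm_eq_of_psum {R : Type*} [CommRing R] {k : ℕ} (z w : Fin k → R)
    (hu : ∀ j : ℕ, 1 ≤ j → j ≤ k → IsUnit (j : R))
    (hs : ∀ j : ℕ, 1 ≤ j → j ≤ k → ∑ i, z i ^ j = ∑ i, w i ^ j) (j : ℕ) (hj : j ≤ k) :
    MvPolynomial.aeval z (MvPolynomial.esymm (Fin k) R j) =
      MvPolynomial.aeval w (MvPolynomial.esymm (Fin k) R j) := by
  induction j using Nat.strong_induction_on with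
  | _ j ih =>
    rcases Nat.eq_zero_or_pos j with h0 | h0
    · subst h0; simp
    · have key := MvPolynomial.mul_esymm_eq_sum (Fin k) R j
      have hz := congrArg (MvPolynomial.aeval z) key
      have hw := congrArg (MvPolynomial.aeval w) key
      have : (j : R) * MvPolynomial.aeval z (MvPolynomial.esymm (Fin k) R j) =
          (j : R) * MvPolynomial.aeval w (MvPolynomial.esymm (Fin k) R j) := by
        rw [map_mul, map_natCast] at hz hw
        rw [hz, hw]
        simp only [map_mul, map_sum, map_pow, map_neg, map_one]
        congr 1
        refine Finset.sum_congr rfl fun a ha => ?_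
        rw [Finset.mem_filter, Finset.HasAntidiagonal.mem_antidiagonal] at ha
        rw [ih a.1 ha.2 (by omega)]
        congr 1
        simp only [MvPolynomial.psum, map_sum, map_pow, MvPolynomial.aeval_X]
        exact hs a.2 (by omega) (by omega)
      exact (hu j h0 hj).mul_left_cancel this

lemma prod_eq_of_psum {R : Type*} [CommRing R] {k : ℕ} (z w : Fin k → R)
    (hu : ∀ j : ℕ, 1 ≤ j → j ≤ k → IsUnit (j : R))
    (hs : ∀ j : ℕ, 1 ≤ j → j ≤ k → ∑ i, z i ^ j = ∑ i, w i ^ j) (x : R) :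
    ∏ i, (x - z i) = ∏ i, (x - w i) := by
  have h : ∀ z : Fin k → R, ∏ i, (x - z i) = ∑ j ∈ Finset.range (k + 1),
      (-1) ^ j * (MvPolynomial.aeval z (MvPolynomial.esymm (Fin k) R j) * x ^ (k - j)) := by
    intro z
    have := Multiset.prod_X_sub_X_eq_sum_esymm (Finset.univ.val.map z)
    have h2 := congrArg (Polynomial.eval x) this
    simp only [Multiset.map_map, Multiset.card_map, Finset.card_val, Finset.card_univ,
      Fintype.card_fin] at h2
    simp only [MvPolynomial.aeval_esymm_eq_multiset_esymm]
    rw [Polynomial.eval_finsetSum] at h2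
    have h3 : Polynomial.eval x (Multiset.map ((fun t => Polynomial.X - Polynomial.C t) ∘ z)
      (Finset.univ : Finset (Fin k)).val).prod = ∏ i, (x - z i) := by
      change Polynomial.eval x (∏ i, (Polynomial.X - Polynomial.C (z i))) = _
      simp [Polynomial.eval_prod]
    rw [h3] at h2
    rw [h2]
    simp
  rw [h z, h w]
  refine Finset.sum_congr rfl fun j hj => ?_
  rw [esymm_eq_of_psum z w hu hs j (by simpa [Nat.lt_succ_iff] using hj)]

lemma exists_perm {R : Type*} [CommRing R] [Nontrivial R] {k : ℕ}
    (hR : ∀ x : R, IsUnit x ∨ IsNilpotent x) (z w : Fin k → R)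
    (hu : ∀ j : ℕ, 1 ≤ j → j ≤ k → IsUnit (j : R))
    (hz : ∀ i j, i ≠ j → IsUnit (z i - z j))
    (hw : ∀ i j, i ≠ j → IsUnit (w i - w j))
    (hs : ∀ j : ℕ, 1 ≤ j → j ≤ k → ∑ i, z i ^ j = ∑ i, w i ^ j) :
    ∃ σ : Equiv.Perm (Fin k), z = w ∘ σ := by
  have h1 : ∀ i, ∃ l, z i = w l := by
    intro i
    have h := prod_eq_of_psum z w hu hs (z i)
    rw [Finset.prod_eq_zero (Finset.mem_univ i) (sub_self _)] at h
    by_cases hl : ∃ l, ¬ IsUnit (z i - w l)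
    · obtain ⟨l, hl⟩ := hl
      refine ⟨l, ?_⟩
      have hn := (hR _).resolve_left hl
      rw [← Finset.mul_prod_erase _ _ (Finset.mem_univ l)] at h
      have hunit : IsUnit (∏ x ∈ Finset.univ.erase l, (z i - w x)) := by
        rw [IsUnit.prod_iff]
        intro m hm
        have hml : l ≠ m := (Finset.ne_of_mem_erase hm).symm
        have : z i - w m = (z i - w l) + (w l - w m) := by ring
        rw [this]
        exact hn.isUnit_add_right_of_commute (hw l m hml) (Commute.all _ _)
      exact sub_eq_zero.1 (hunit.mul_left_eq_zero.1 h.symm)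
    · push Not at hl
      have : IsUnit (∏ x, (z i - w x)) := by
        rw [IsUnit.prod_iff]; intro m _; exact hl m
      rw [← h] at this
      exact absurd this not_isUnit_zero
  choose σ hσ using h1
  have inj : Function.Injective σ := by
    intro a b hab
    by_contra hne
    have := hz a b hne
    rw [hσ a, hσ b, hab, sub_self] at this
    exact not_isUnit_zero this
  refine ⟨Equiv.ofBijective σ (Finite.injective_iff_bijective.1 inj), ?_⟩
  funext i; simp [hσ i]

lemma zmod_unit_or_nil (p m : ℕ) (hp : p.Prime) (x : ZMod (p ^ m)) :
    IsUnit x ∨ IsNilpotent x := by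
  have : NeZero (p ^ m) := ⟨pow_ne_zero _ hp.ne_zero⟩
  by_cases h : p ∣ x.val
  · right
    refine ⟨m, ?_⟩
    rw [← ZMod.natCast_zmod_val x, ← Nat.cast_pow, ZMod.natCast_eq_zero_iff]
    exact pow_dvd_pow_of_dvd h m
  · left
    rw [← ZMod.natCast_zmod_val x, ZMod.isUnit_iff_coprime]
    exact Nat.Coprime.pow_right _ ((Nat.Prime.coprime_iff_not_dvd hp).2 h).symm

lemma zmod_intCast_unit (p m : ℕ) (hp : p.Prime) (x : ℤ) (h : ¬ (p : ℤ) ∣ x) :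
    IsUnit (x : ZMod (p ^ m)) := by
  have hc : IsCoprime x ((p ^ m : ℕ) : ℤ) := by
    push_cast
    apply IsCoprime.pow_right
    exact ((Prime.coprime_iff_not_dvd (Nat.prime_iff_prime_int.1 hp)).2 h).symm
  obtain ⟨a, b, hab⟩ := hc
  have := congrArg (Int.cast : ℤ → ZMod (p ^ m)) hab
  push_cast at this
  have h0 : (p : ZMod (p ^ m)) ^ m = 0 := by
    rw [← Nat.cast_pow, ZMod.natCast_self]
  rw [h0, mul_zero, add_zero] at this
  exact IsUnit.of_mul_eq_one_right _ this

/-- Linnik's lemma. -/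
lemma linnik (k p a P : ℕ) (hp : p.Prime) (hkp : k < p) (ha : 1 ≤ a) (hk : 1 ≤ k)
    (hP : P ≤ (p ^ a) ^ k) (c : ℤ) (lam : Fin k → ℤ) (S : Finset (Fin k → Fin P))
    (hinj : ∀ x ∈ S, ∀ i j, i ≠ j → ¬ (p : ℤ) ∣ ((x i : ℤ) - (x j : ℤ)))
    (hcong : ∀ x ∈ S, ∀ j : Fin k, ((p ^ a : ℕ) : ℤ) ^ (j.val + 1) ∣
      (∑ i, ((x i : ℤ) - c) ^ (j.val + 1)) - lam j) :
    S.card ≤ k.factorial * (p ^ a) ^ (k * (k - 1) / 2) := by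
  classical
  set q := p ^ a with hq
  have hqpos : 0 < q := pow_pos hp.pos _
  have hqk : q ^ k = p ^ (a * k) := by rw [hq, ← pow_mul]
  have hak : 1 ≤ a * k := Nat.mul_pos ha hk
  have : NeZero (p ^ (a * k)) := ⟨pow_ne_zero _ hp.ne_zero⟩
  have : Fact (1 < p ^ (a * k)) := ⟨Nat.one_lt_pow (by omega) hp.one_lt⟩
  let Z : (Fin k → Fin P) → (Fin k → ZMod (p ^ (a * k))) := fun x i => (((x i : ℤ) - c : ℤ) : ZMod (p ^ (a * k)))
  let π : (Fin k → Fin P) → (Fin k → ZMod (p ^ (a * k))) := fun x j => ∑ i, (Z x i) ^ (j.val + 1)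
  let T : Fin k → Finset (ZMod (p ^ (a * k))) := fun j =>
    (Finset.range (q ^ (k - (j.val + 1)))).image (fun m : ℕ => (lam j : ZMod (p ^ (a * k))) + (q : ZMod (p ^ (a * k))) ^ (j.val + 1) * (m : ZMod (p ^ (a * k))))
  have hmaps : ∀ x ∈ S, π x ∈ Fintype.piFinset T := by
    intro x hx
    rw [Fintype.mem_piFinset]
    intro j
    obtain ⟨d, hd⟩ := hcong x hx j
    rw [Finset.mem_image]
    set Q := q ^ (k - (j.val + 1)) with hQ
    have hQpos : 0 < Q := pow_pos hqpos _
    refine ⟨(d % (Q : ℤ)).toNat, ?_, ?_⟩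
    · rw [Finset.mem_range]
      have h1 := Int.emod_lt_of_pos d (show (0 : ℤ) < Q by exact_mod_cast hQpos)
      have h2 := Int.emod_nonneg d (show (Q : ℤ) ≠ 0 by exact_mod_cast hQpos.ne')
      omega
    · have h2 := Int.emod_nonneg d (show (Q : ℤ) ≠ 0 by exact_mod_cast hQpos.ne')
      have h3 : (((d % (Q : ℤ)).toNat : ℕ) : ZMod (p ^ (a * k))) = ((d % (Q : ℤ) : ℤ) : ZMod (p ^ (a * k))) := by
        conv_rhs => rw [← Int.toNat_of_nonneg h2]
        rw [Int.cast_natCast]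
      rw [h3]
      have h4 : π x j = (((∑ i, ((x i : ℤ) - c) ^ (j.val + 1)) : ℤ) : ZMod (p ^ (a * k))) := by
        simp [π, Z]
      rw [h4, show (∑ i, ((x i : ℤ) - c) ^ (j.val + 1)) = lam j + (q : ℤ) ^ (j.val + 1) * d by
        linarith]
      rw [Int.emod_def]
      push_cast
      have h5 : (q : ZMod (p ^ (a * k))) ^ (j.val + 1) * (Q : ZMod (p ^ (a * k))) = 0 := by
        rw [hQ, ← Nat.cast_pow, ← Nat.cast_mul, ← pow_add,
          show j.val + 1 + (k - (j.val + 1)) = k by omega, hqk, ZMod.natCast_self]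
      linear_combination (-((d / (Q : ℤ) : ℤ) : ZMod (p ^ (a * k)))) * h5
  have hZinj : Set.InjOn Z S := by
    intro x _ y _ hxy
    funext i
    have h := congrFun hxy i
    simp only [Z] at h
    have h' : ((x i : ℤ) : ZMod (p ^ (a * k))) = ((y i : ℤ) : ZMod (p ^ (a * k))) := by
      push_cast at h ⊢
      exact sub_left_inj.1 h
    have h'' := (ZMod.intCast_eq_intCast_iff _ _ _).1 h'
    have hx : ((x i : ℕ)) < p ^ (a * k) := by rw [← hqk]; exact lt_of_lt_of_le (x i).2 hP
    have hy : ((y i : ℕ)) < p ^ (a * k) := by rw [← hqk]; exact lt_of_lt_of_le (y i).2 hP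
    have := Nat.ModEq.eq_of_lt_of_lt ((Int.natCast_modEq_iff).1 h'') hx hy
    exact Fin.ext this
  have hfib : ∀ b ∈ S.image π, (S.filter (fun x => π x = b)).card ≤ k.factorial := by
    intro b hb
    obtain ⟨x0, hx0, rfl⟩ := Finset.mem_image.1 hb
    have hun : ∀ x ∈ S, ∀ i j, i ≠ j → IsUnit (Z x i - Z x j) := by
      intro x hx i j hij
      have := zmod_intCast_unit p (a * k) hp _ (hinj x hx i j hij)
      simp only [Z]
      push_cast at this ⊢
      rwa [sub_sub_sub_cancel_right]
    have hsub : (S.filter (fun x => π x = π x0)).image Z ⊆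
        (Finset.univ : Finset (Equiv.Perm (Fin k))).image (fun σ : Equiv.Perm (Fin k) => Z x0 ∘ σ) := by
      intro z hz
      obtain ⟨x, hx, rfl⟩ := Finset.mem_image.1 hz
      rw [Finset.mem_filter] at hx
      obtain ⟨σ, hσ⟩ := exists_perm (zmod_unit_or_nil p (a * k) hp) (Z x) (Z x0)
        (by
          intro j h1 h2
          have := zmod_intCast_unit p (a * k) hp (j : ℤ) (by
            intro hd
            have := Nat.le_of_dvd h1 (Int.natCast_dvd_natCast.1 hd)
            omega)
          simpa using this)
        (hun x hx.1) (hun x0 hx0)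
        (by
          intro j h1 h2
          have := congrFun hx.2 ⟨j - 1, by omega⟩
          simp only [π] at this
          rwa [show j - 1 + 1 = j by omega] at this)
      exact Finset.mem_image.2 ⟨σ, Finset.mem_univ _, hσ.symm⟩
    calc (S.filter (fun x => π x = π x0)).card
        = ((S.filter (fun x => π x = π x0)).image Z).card := by
          rw [Finset.card_image_of_injOn]
          exact hZinj.mono (by intro x hx; exact (Finset.mem_filter.1 hx).1)
      _ ≤ _ := Finset.card_le_card hsub
      _ ≤ _ := Finset.card_image_le
      _ = k.factorial := by rw [Finset.card_univ, Fintype.card_perm, Fintype.card_fin]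
  have h1 := Finset.card_le_mul_card_image (s := S) (f := π) k.factorial hfib
  refine h1.trans (Nat.mul_le_mul_left _ ?_)
  calc (S.image π).card ≤ (Fintype.piFinset T).card := by
        apply Finset.card_le_card
        intro b hb
        obtain ⟨x, hx, rfl⟩ := Finset.mem_image.1 hb
        exact hmaps x hx
    _ = ∏ j, (T j).card := Fintype.card_piFinset _
    _ ≤ ∏ j : Fin k, q ^ (k - (j.val + 1)) := by
        apply Finset.prod_le_prod' 
        intro j _
        exact Finset.card_image_le.trans (by simp)
    _ = q ^ (∑ j : Fin k, (k - (j.val + 1))) := by rw [Finset.prod_pow_eq_pow_sum]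
    _ = q ^ (k * (k - 1) / 2) := by
        congr 1
        rw [Fin.sum_univ_eq_sum_range (fun j => k - (j + 1)) k]
        have := Finset.sum_range_reflect (fun j => j) k
        rw [← Finset.sum_range_id, ← this]
        refine Finset.sum_congr rfl fun j _ => by omega

end VK


namespace VK
open Filter

/-- evaluation of a character of `(ℤ/(L+1))^k` on an integer vector -/
noncomputable def ev {k L : ℕ} (ψ : AddChar (Fin k → ZMod (L + 1)) ℂ) (v : Fin k → ℤ) : ℂ :=
  ψ (fun j => (v j : ZMod (L + 1)))

lemma ev_add {k L : ℕ} (ψ : AddChar (Fin k → ZMod (L + 1)) ℂ) (v w : Fin k → ℤ) :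
    ev ψ (v + w) = ev ψ v * ev ψ w := by
  unfold ev
  rw [← AddChar.map_add_eq_mul]
  congr 1; funext j; simp

lemma ev_zero {k L : ℕ} (ψ : AddChar (Fin k → ZMod (L + 1)) ℂ) : ev ψ 0 = 1 := by
  unfold ev
  have : (fun j : Fin k => (((0 : Fin k → ℤ) j : ℤ) : ZMod (L + 1))) = 0 := by funext j; simp
  rw [this, AddChar.map_zero_eq_one ψ]

lemma ev_sum {k L : ℕ} (ψ : AddChar (Fin k → ZMod (L + 1)) ℂ) {ι : Type*} (s : Finset ι)
    (v : ι → Fin k → ℤ) : ev ψ (∑ i ∈ s, v i) = ∏ i ∈ s, ev ψ (v i) := by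
  classical
  induction s using Finset.induction_on with
  | empty => simp [ev_zero]
  | insert a s ha ih => rw [Finset.sum_insert ha, Finset.prod_insert ha, ev_add, ih]

lemma norm_ev {k L : ℕ} (ψ : AddChar (Fin k → ZMod (L + 1)) ℂ) (v : Fin k → ℤ) :
    ‖ev ψ v‖ = 1 := AddChar.norm_apply _ _

lemma ev_neg {k L : ℕ} (ψ : AddChar (Fin k → ZMod (L + 1)) ℂ) (v : Fin k → ℤ) :
    ev ψ (-v) = (starRingEnd ℂ) (ev ψ v) := by
  unfold ev
  rw [← AddChar.map_neg_eq_conj]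
  congr 1; funext j; simp

lemma sum_ev {k L : ℕ} (v : Fin k → ℤ) (hv : ∀ j, |v j| ≤ L) :
    ∑ ψ : AddChar (Fin k → ZMod (L + 1)) ℂ, ev ψ v = if v = 0 then ((L + 1 : ℕ) : ℂ) ^ k else 0 := by
  classical
  unfold ev
  rw [AddChar.sum_apply_eq_ite]
  have : ((fun j => (v j : ZMod (L + 1))) = 0) ↔ v = 0 := by
    constructor
    · intro h
      funext j
      have h1 := congrFun h j
      simp only [Pi.zero_apply] at h1
      rw [ZMod.intCast_zmod_eq_zero_iff_dvd] at h1
      apply Int.eq_zero_of_abs_lt_dvd h1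
      have := hv j
      push_cast
      omega
    · rintro rfl; funext j; simp
  simp only [this]
  split_ifs <;> simp

/-- number of ordered pairs in `S` with difference `μ` -/
noncomputable def EC {ι : Type*} {k : ℕ} (S : Finset ι) (w : ι → Fin k → ℤ) (μ : Fin k → ℤ) : ℕ :=
  by classical exact ((S ×ˢ S).filter (fun i => w i.1 - w i.2 = μ)).card

lemma orth {ι : Type*} {k : ℕ} (S : Finset ι) (w : ι → Fin k → ℤ) (μ : Fin k → ℤ) :
    ∀ᶠ L : ℕ in atTop, ∑ ψ : AddChar (Fin k → ZMod (L + 1)) ℂ,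
      ((‖∑ i ∈ S, ev ψ (w i)‖ ^ 2 : ℝ) : ℂ) * ev ψ (-μ) = ((L + 1 : ℕ) : ℂ) ^ k * EC S w μ := by
  classical
  have hev : ∀ᶠ L : ℕ in atTop, ∀ i ∈ S ×ˢ S, ∀ j : Fin k, |(w i.1 - w i.2 - μ) j| ≤ (L : ℤ) := by
    rw [Finset.eventually_all]
    intro i _
    rw [Filter.eventually_all]
    intro j
    filter_upwards [eventually_ge_atTop (|(w i.1 - w i.2 - μ) j|).toNat] with L hL
    omega
  filter_upwards [hev] with L hL
  have h1 : ∀ ψ : AddChar (Fin k → ZMod (L + 1)) ℂ,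
      ((‖∑ i ∈ S, ev ψ (w i)‖ ^ 2 : ℝ) : ℂ) * ev ψ (-μ) =
        ∑ i ∈ S ×ˢ S, ev ψ (w i.1 - w i.2 - μ) := by
    intro ψ
    have : ((‖∑ i ∈ S, ev ψ (w i)‖ ^ 2 : ℝ) : ℂ) = (∑ i ∈ S, ev ψ (w i)) *
        (starRingEnd ℂ) (∑ i ∈ S, ev ψ (w i)) := by
      rw [Complex.mul_conj, Complex.normSq_eq_norm_sq]
    rw [this, map_sum, Finset.sum_mul_sum, ← Finset.sum_product', Finset.sum_mul]
    refine Finset.sum_congr rfl fun i _ => ?_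
    rw [← ev_neg, ← ev_add, ← ev_add]
    congr 1
  simp only [h1]
  rw [Finset.sum_comm]
  have h2 : ∀ i ∈ S ×ˢ S, ∑ ψ : AddChar (Fin k → ZMod (L + 1)) ℂ, ev ψ (w i.1 - w i.2 - μ) =
      if w i.1 - w i.2 = μ then ((L + 1 : ℕ) : ℂ) ^ k else 0 := by
    intro i hi
    rw [sum_ev _ (hL i hi)]
    simp only [sub_eq_zero]
  rw [Finset.sum_congr rfl h2, ← Finset.sum_filter, Finset.sum_const, nsmul_eq_mul, mul_comm]
  unfold EC
  congr!

lemma orth0 {ι : Type*} {k : ℕ} (S : Finset ι) (w : ι → Fin k → ℤ) :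
    ∀ᶠ L : ℕ in atTop, ∑ ψ : AddChar (Fin k → ZMod (L + 1)) ℂ,
      ‖∑ i ∈ S, ev ψ (w i)‖ ^ 2 = ((L + 1 : ℕ) : ℝ) ^ k * EC S w 0 := by
  filter_upwards [orth S w 0] with L hL
  simp only [neg_zero, ev_zero, mul_one] at hL
  exact_mod_cast hL

lemma EC_le {ι : Type*} {k : ℕ} (S : Finset ι) (w : ι → Fin k → ℤ) (μ : Fin k → ℤ) :
    EC S w μ ≤ EC S w 0 := by
  obtain ⟨L, h1, h2⟩ := ((orth S w μ).and (orth0 S w)).exists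
  have h3 := congrArg norm h1
  rw [norm_mul, norm_pow, Complex.norm_natCast, Complex.norm_natCast] at h3
  have h4 : ((L + 1 : ℕ) : ℝ) ^ k * EC S w μ ≤ ((L + 1 : ℕ) : ℝ) ^ k * EC S w 0 := by
    rw [← h3, ← h2]
    refine (norm_sum_le _ _).trans (Finset.sum_le_sum fun ψ _ => ?_)
    rw [norm_mul, norm_ev, mul_one, Complex.norm_real, Real.norm_of_nonneg (by positivity)]
  have := le_of_mul_le_mul_left h4 (by positivity)
  exact_mod_cast this

lemma EC_zero_eq {ι : Type*} [Fintype ι] {k : ℕ} (S : Finset ι) (w : ι → Fin k → ℤ) :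
    EC S w 0 = ∑ v ∈ (Finset.univ : Finset ι).image w, (S.filter (fun i => w i = v)).card ^ 2 := by
  classical
  unfold EC
  rw [Finset.card_eq_sum_card_fiberwise (f := fun i => w i.1)
    (t := (Finset.univ : Finset ι).image w)]
  · refine Finset.sum_congr rfl fun v _ => ?_
    rw [sq, ← Finset.card_product]
    congr 1
    ext ⟨i, i'⟩
    simp only [Finset.mem_filter, Finset.mem_product, sub_eq_zero]
    constructor
    · rintro ⟨⟨⟨h1, h2⟩, h3⟩, h4⟩; exact ⟨⟨h1, h4⟩, h2, h3 ▸ h4⟩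
    · rintro ⟨⟨h1, h4⟩, h2, h3⟩; exact ⟨⟨⟨h1, h2⟩, h4.trans h3.symm⟩, h4⟩
  · intro i _; simp

lemma EC_cover {ι γ : Type*} [Fintype ι] {k : ℕ} (S : Finset ι) (w : ι → Fin k → ℤ)
    (C : Finset γ) (T : γ → Finset ι) (h : ∀ i ∈ S, ∃ c ∈ C, i ∈ T c) :
    EC S w 0 ≤ C.card * ∑ c ∈ C, EC (T c) w 0 := by
  classical
  simp only [EC_zero_eq]
  rw [Finset.sum_comm, Finset.mul_sum]
  refine Finset.sum_le_sum fun v _ => ?_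
  have h1 : (S.filter (fun i => w i = v)).card ≤ ∑ c ∈ C, ((T c).filter (fun i => w i = v)).card := by
    refine (Finset.card_le_card ?_).trans Finset.card_biUnion_le
    intro i hi
    rw [Finset.mem_filter] at hi
    obtain ⟨c, hc, hi'⟩ := h i hi.1
    exact Finset.mem_biUnion.2 ⟨c, hc, Finset.mem_filter.2 ⟨hi', hi.2⟩⟩
  exact (Nat.pow_le_pow_left h1 2).trans sq_sum_le_card_mul_sum_sq

/-- moment curve -/
def vv (k : ℕ) (x : ℤ) : Fin k → ℤ := fun j => x ^ (j.val + 1)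

lemma affine_aux {ι R : Type*} [Fintype ι] [CommRing R] (k : ℕ) (x y : ι → R) (b c : R)
    (h : ∀ j ≤ k, ∑ i, x i ^ j = ∑ i, y i ^ j) :
    ∀ j ≤ k, ∑ i, (b * x i + c) ^ j = ∑ i, (b * y i + c) ^ j := by
  intro j hj
  simp only [add_pow, mul_pow]
  rw [Finset.sum_comm, Finset.sum_comm (s := Finset.univ)]
  refine Finset.sum_congr rfl fun m hm => ?_
  have hm' : m ≤ k := by rw [Finset.mem_range] at hm; omega
  have := h m hm'
  simp only [← Finset.sum_mul, ← Finset.mul_sum]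
  rw [this]

lemma vv_sum_iff {ι : Type*} [Fintype ι] (k : ℕ) (x y : ι → ℤ) :
    (∑ i, vv k (x i) = ∑ i, vv k (y i)) ↔ ∀ j ≤ k, ∑ i, x i ^ j = ∑ i, y i ^ j := by
  constructor
  · intro h j hj
    rcases Nat.eq_zero_or_pos j with rfl | h0
    · simp
    · have := congrFun h ⟨j - 1, by omega⟩
      simp only [vv, Finset.sum_apply] at this
      rwa [show j - 1 + 1 = j by omega] at this
  · intro h
    funext j
    simp only [vv, Finset.sum_apply]
    exact h _ (by omega)

lemma vv_affine {ι : Type*} [Fintype ι] (k : ℕ) (x y : ι → ℤ) (b c : ℤ) (hb : b ≠ 0) :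
    (∑ i, vv k (c + b * x i) = ∑ i, vv k (c + b * y i)) ↔
      (∑ i, vv k (x i) = ∑ i, vv k (y i)) := by
  rw [vv_sum_iff, vv_sum_iff]
  constructor
  · intro h j hj
    have h' : ∀ j ≤ k, ∑ i, ((c + b * x i : ℤ) : ℚ) ^ j = ∑ i, ((c + b * y i : ℤ) : ℚ) ^ j := by
      intro j hj; exact_mod_cast h j hj
    have h2 := affine_aux k _ _ ((b : ℚ)⁻¹) (-(b : ℚ)⁻¹ * c) h' j hj
    have hb' : (b : ℚ) ≠ 0 := by exact_mod_cast hb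
    have e : ∀ z : ℤ, (b : ℚ)⁻¹ * ((c + b * z : ℤ) : ℚ) + -(b : ℚ)⁻¹ * c = z := by
      intro z; push_cast; field_simp; ring
    simp only [e] at h2
    exact_mod_cast h2
  · intro h j hj
    have := affine_aux k x y b c h j hj
    simpa only [add_comm c] using this

/-- Vinogradov's mean value -/
noncomputable def JJ (k s P : ℕ) : ℕ :=
  EC (Finset.univ : Finset (Fin s → Fin P)) (fun x => ∑ i, vv k ((x i : ℕ) : ℤ)) 0

lemma JJ_affine (k s P : ℕ) (c b : ℤ) (hb : b ≠ 0) :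
    EC (Finset.univ : Finset (Fin s → Fin P)) (fun x => ∑ i, vv k (c + b * ((x i : ℕ) : ℤ))) 0
      = JJ k s P := by
  classical
  unfold JJ EC
  congr 1
  ext ⟨x, y⟩
  simp only [Finset.mem_filter, sub_eq_zero]
  rw [vv_affine k _ _ b c hb]

lemma pow_sum_ev {k L : ℕ} (ψ : AddChar (Fin k → ZMod (L + 1)) ℂ) (s P : ℕ)
    (g : Fin P → Fin k → ℤ) :
    (∑ y : Fin P, ev ψ (g y)) ^ s = ∑ x : Fin s → Fin P, ev ψ (∑ i, g (x i)) := by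
  simp only [ev_sum]
  rw [Fintype.sum_pow (fun y => ev ψ (g y)) s]

lemma JF (k s P : ℕ) (c b : ℤ) (hb : b ≠ 0) :
    ∀ᶠ L : ℕ in atTop, ∑ ψ : AddChar (Fin k → ZMod (L + 1)) ℂ,
      ‖∑ y : Fin P, ev ψ (vv k (c + b * ((y : ℕ) : ℤ)))‖ ^ (2 * s) =
        ((L + 1 : ℕ) : ℝ) ^ k * JJ k s P := by
  filter_upwards [orth0 (Finset.univ : Finset (Fin s → Fin P))
    (fun x => ∑ i, vv k (c + b * ((x i : ℕ) : ℤ)))] with L hL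
  rw [JJ_affine k s P c b hb] at hL
  rw [← hL]
  refine Finset.sum_congr rfl fun ψ _ => ?_
  rw [← pow_sum_ev ψ s P (fun y => vv k (c + b * ((y : ℕ) : ℤ))), norm_pow, ← pow_mul, mul_comm]

end VK


namespace VK
open Filter

noncomputable def ff {k L : ℕ} (ψ : AddChar (Fin k → ZMod (L + 1)) ℂ) (P : ℕ) (c b : ℤ) : ℂ :=
  ∑ y : Fin P, ev ψ (vv k (c + b * ((y : ℕ) : ℤ)))

lemma ff_split {k L : ℕ} (ψ : AddChar (Fin k → ZMod (L + 1)) ℂ) (P q : ℕ) :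
    ff ψ (P * q) 0 1 = ∑ a : Fin q, ff ψ P (a : ℕ) q := by
  unfold ff
  rw [Finset.sum_comm, ← finProdFinEquiv.sum_comp, Fintype.sum_prod_type]
  refine Finset.sum_congr rfl fun y _ => Finset.sum_congr rfl fun a _ => ?_
  congr 2
  simp [finProdFinEquiv]

lemma good_count (k p a q s P' : ℕ) (hq : q = p ^ a) (hp : p.Prime) (hkp : k < p) (ha : 1 ≤ a) (hk : 1 ≤ k)
    (hP : P' * q ≤ q ^ k) (c : ℤ)
    (S : Finset (Fin k → Fin (P' * q)))
    (hinj : ∀ x ∈ S, ∀ i j, i ≠ j → ¬ (p : ℤ) ∣ (((x i : ℕ) : ℤ) - ((x j : ℕ) : ℤ))) :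
    EC (S ×ˢ (Finset.univ : Finset (Fin s → Fin P')))
      (fun z => ∑ i, vv k ((z.1 i : ℕ) : ℤ) + ∑ i, vv k (c + ((q : ℕ) : ℤ) * ((z.2 i : ℕ) : ℤ))) 0
      ≤ JJ k s P' * (k.factorial * q ^ (k * (k - 1) / 2) * (P' * q) ^ k) := by
  classical
  have hq0 : ((q : ℕ) : ℤ) ≠ 0 := by
    have : 0 < q := hq ▸ pow_pos hp.pos _
    exact_mod_cast this.ne'
  set w : (Fin k → Fin (P' * q)) × (Fin s → Fin P') → Fin k → ℤ :=
    (fun z => ∑ i, vv k ((z.1 i : ℕ) : ℤ) + ∑ i, vv k (c + (q : ℤ) * ((z.2 i : ℕ) : ℤ))) with hw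
  set U := (S ×ˢ (Finset.univ : Finset (Fin s → Fin P'))) with hU
  let F := ((U ×ˢ U).filter (fun i => w i.1 - w i.2 = 0))
  have hEC : EC U w 0 = F.card := by unfold EC; congr!
  rw [hEC]
  let π : ((Fin k → Fin (P' * q)) × (Fin s → Fin P')) × ((Fin k → Fin (P' * q)) × (Fin s → Fin P')) →
    (Fin k → Fin (P' * q)) × (Fin k → Fin (P' * q)) := fun z => (z.1.1, z.2.1)
  have hcard1 : F.card ≤ JJ k s P' * (F.image π).card := by
    apply Finset.card_le_mul_card_image
    rintro ⟨x, y⟩ _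
    rw [← JJ_affine k s P' c q hq0]
    refine le_trans ?_ (EC_le _ _ (∑ i, vv k ((y i : ℕ) : ℤ) - ∑ i, vv k ((x i : ℕ) : ℤ)))
    unfold EC
    apply Finset.card_le_card_of_injOn (fun z => (z.1.2, z.2.2))
    · rintro ⟨⟨x1, u⟩, ⟨y1, v⟩⟩ hz
      simp only [Finset.coe_filter, Set.mem_ofPred_eq, π, Prod.mk.injEq] at hz
      obtain ⟨hz1, rfl, rfl⟩ := hz
      have hz2 := (Finset.mem_filter.1 hz1).2
      simp only [hw] at hz2
      simp only [Finset.coe_filter, Set.mem_ofPred_eq]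
      refine ⟨by simp, ?_⟩
      rw [sub_eq_zero] at hz2
      rw [sub_eq_sub_iff_add_eq_add]
      rw [add_comm, hz2, add_comm]
    · rintro ⟨⟨x1, u⟩, ⟨y1, v⟩⟩ hz ⟨⟨x2, u'⟩, ⟨y2, v'⟩⟩ hz' h
      simp only [Finset.coe_filter, Set.mem_ofPred_eq, π, Prod.mk.injEq] at hz hz' h
      obtain ⟨_, rfl, rfl⟩ := hz
      obtain ⟨_, rfl, rfl⟩ := hz'
      simp [h.1, h.2]
  refine hcard1.trans (Nat.mul_le_mul_left _ ?_)
  have hcard2 : (F.image π).card ≤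
      (k.factorial * q ^ (k * (k - 1) / 2)) * ((F.image π).image Prod.snd).card := by
    apply Finset.card_le_mul_card_image
    intro y _
    have : ((F.image π).filter (fun z => z.2 = y)).card =
        (((F.image π).filter (fun z => z.2 = y)).image Prod.fst).card := by
      rw [Finset.card_image_of_injOn]
      rintro ⟨x1, y1⟩ h1 ⟨x2, y2⟩ h2 h
      simp only [Finset.coe_filter, Set.mem_ofPred_eq] at h1 h2 h
      rw [h, h1.2, h2.2]
    rw [this]
    have key : ∀ x ∈ ((F.image π).filter (fun z => z.2 = y)).image Prod.fst,
        x ∈ S ∧ ∀ j : Fin k, ((q : ℕ) : ℤ) ^ (j.val + 1) ∣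
          (∑ i, (((x i : ℕ) : ℤ) - c) ^ (j.val + 1)) -
            ∑ i, (((y i : ℕ) : ℤ) - c) ^ (j.val + 1) := by
      intro x hx
      simp only [Finset.mem_image, Finset.mem_filter] at hx
      obtain ⟨⟨x1, y1⟩, ⟨⟨⟨⟨x2, u⟩, ⟨y2, v⟩⟩, hz, hzz⟩, h2⟩, h3⟩ := hx
      simp only [π, Prod.mk.injEq] at hzz h2 h3
      obtain ⟨rfl, rfl⟩ := hzz
      subst h2; subst h3
      obtain ⟨hz1, hz2⟩ := Finset.mem_filter.1 hz
      rw [Finset.mem_product] at hz1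
      refine ⟨(Finset.mem_product.1 hz1.1).1, ?_⟩
      intro j
      rw [sub_eq_zero] at hz2
      simp only [hw] at hz2
      -- combine into sum types
      have h4 : ∑ i : Fin k ⊕ Fin s, vv k (Sum.elim (fun i => ((x2 i : ℕ) : ℤ))
          (fun i => c + (q : ℤ) * ((u i : ℕ) : ℤ)) i) = ∑ i : Fin k ⊕ Fin s, vv k
          (Sum.elim (fun i => ((y2 i : ℕ) : ℤ)) (fun i => c + (q : ℤ) * ((v i : ℕ) : ℤ)) i) := by
        rw [Fintype.sum_sum_type, Fintype.sum_sum_type]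
        exact hz2
      rw [vv_sum_iff] at h4
      have h5 := affine_aux k _ _ 1 (-c) h4 (j.val + 1) (by omega)
      rw [Fintype.sum_sum_type, Fintype.sum_sum_type] at h5
      simp only [Sum.elim_inl, Sum.elim_inr] at h5
      have e : ∀ u : Fin s → Fin P', (q : ℤ) ^ (j.val + 1) ∣
          ∑ i, (1 * (c + (q : ℤ) * ((u i : ℕ) : ℤ)) + -c) ^ (j.val + 1) := by
        intro u
        apply Finset.dvd_sum
        intro i _
        rw [show (1 * (c + (q : ℤ) * ((u i : ℕ) : ℤ)) + -c) = (q : ℤ) * ((u i : ℕ) : ℤ) by ring,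
          mul_pow]
        exact dvd_mul_right _ _
      have h6 : (∑ i, (((x2 i : ℕ) : ℤ) - c) ^ (j.val + 1)) -
            ∑ i, (((y2 i : ℕ) : ℤ) - c) ^ (j.val + 1) =
          ∑ i, (1 * (c + (q : ℤ) * ((v i : ℕ) : ℤ)) + -c) ^ (j.val + 1) -
          ∑ i, (1 * (c + (q : ℤ) * ((u i : ℕ) : ℤ)) + -c) ^ (j.val + 1) := by
        simp only [one_mul, ← sub_eq_add_neg] at h5 ⊢
        linarith
      rw [h6]
      exact dvd_sub (e v) (e u)
    subst hq
    exact linnik k p a (P' * p ^ a) hp hkp ha hk hP c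
      (fun j => ∑ i, (((y i : ℕ) : ℤ) - c) ^ (j.val + 1)) _
      (fun x hx => hinj x (key x hx).1) (fun x hx => (key x hx).2)
  refine hcard2.trans (Nat.mul_le_mul_left _ ?_)
  refine (Finset.card_le_univ _).trans ?_
  simp

end VK


namespace VK
open Filter

lemma powmean {ι : Type*} (S : Finset ι) (z : ι → ℂ) (m : ℕ) (hm : 1 ≤ m) :
    ‖∑ i ∈ S, z i‖ ^ m ≤ (S.card : ℝ) ^ (m - 1) * ∑ i ∈ S, ‖z i‖ ^ m := by
  obtain ⟨n, rfl⟩ : ∃ n, m = n + 1 := ⟨m - 1, by omega⟩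
  have h1 := pow_sum_div_card_le_sum_pow (s := S) (f := fun i => ‖z i‖) (fun i _ => norm_nonneg _) n
  have h2 : ‖∑ i ∈ S, z i‖ ^ (n + 1) ≤ (∑ i ∈ S, ‖z i‖) ^ (n + 1) :=
    pow_le_pow_left₀ (norm_nonneg _) (norm_sum_le _ _) _
  refine h2.trans ?_
  simp only [Nat.add_sub_cancel]
  rcases S.eq_empty_or_nonempty with rfl | hS
  · simp
  · have : (0 : ℝ) < (S.card : ℝ) ^ n := pow_pos (by exact_mod_cast hS.card_pos) _
    rw [div_le_iff₀ this] at h1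
    linarith

lemma sum_prod_ev {k L : ℕ} (ψ : AddChar (Fin k → ZMod (L + 1)) ℂ) {s P : ℕ} {ι : Type*}
    (S : Finset ι) (u : ι → Fin k → ℤ) (g : Fin P → Fin k → ℤ) :
    ∑ z ∈ S ×ˢ (Finset.univ : Finset (Fin s → Fin P)), ev ψ (u z.1 + ∑ i, g (z.2 i)) =
      (∑ x ∈ S, ev ψ (u x)) * (∑ y : Fin P, ev ψ (g y)) ^ s := by
  rw [Finset.sum_product, pow_sum_ev, Finset.sum_mul_sum]
  simp only [ev_add]

lemma good_EC (k p a q s P' P : ℕ) (hP0 : P = P' * q) (hq : q = p ^ a) (hp : p.Prime) (hkp : k < p)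
    (ha : 1 ≤ a) (hk : 1 ≤ k) (hs : 1 ≤ s)
    (hP : P ≤ q ^ k) (S : Finset (Fin k → Fin P))
    (hinj : ∀ x ∈ S, ∀ i j, i ≠ j → ¬ (p : ℤ) ∣ (((x i : ℕ) : ℤ) - ((x j : ℕ) : ℤ))) :
    (EC (S ×ˢ (Finset.univ : Finset (Fin s → Fin P)))
      (fun z => ∑ i, vv k ((z.1 i : ℕ) : ℤ) + ∑ i, vv k ((z.2 i : ℕ) : ℤ)) 0 : ℝ)
      ≤ (q : ℝ) ^ (2 * s) * (JJ k s P' * (k.factorial * q ^ (k * (k - 1) / 2) * P ^ k)) := by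
  subst hP0
  have hall : ∀ᶠ L : ℕ in atTop, ∀ c : Fin q, ∑ ψ : AddChar (Fin k → ZMod (L + 1)) ℂ,
      ‖∑ z ∈ (S ×ˢ (Finset.univ : Finset (Fin s → Fin P'))), ev ψ (∑ i, vv k ((z.1 i : ℕ) : ℤ) +
        ∑ i, vv k (((c : ℕ) : ℤ) + (q : ℤ) * ((z.2 i : ℕ) : ℤ)))‖ ^ 2 =
        ((L + 1 : ℕ) : ℝ) ^ k * EC (S ×ˢ (Finset.univ : Finset (Fin s → Fin P')))
      (fun z => ∑ i, vv k ((z.1 i : ℕ) : ℤ) + ∑ i, vv k (((c : ℕ) : ℤ) + (q : ℤ) * ((z.2 i : ℕ) : ℤ))) 0 := by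
    rw [Filter.eventually_all]
    intro c
    exact orth0 _ _
  obtain ⟨L, h1, h2⟩ := ((orth0 (S ×ˢ (Finset.univ : Finset (Fin s → Fin (P' * q))))
      (fun z => ∑ i, vv k ((z.1 i : ℕ) : ℤ) + ∑ i, vv k ((z.2 i : ℕ) : ℤ))).and hall).exists
  have hLpos : (0 : ℝ) < ((L + 1 : ℕ) : ℝ) ^ k := by positivity
  refine le_of_mul_le_mul_left ?_ hLpos
  rw [← h1]
  have h3 : ∀ ψ : AddChar (Fin k → ZMod (L + 1)) ℂ,
      ‖∑ z ∈ (S ×ˢ (Finset.univ : Finset (Fin s → Fin (P' * q)))), ev ψ (∑ i, vv k ((z.1 i : ℕ) : ℤ) +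
        ∑ i, vv k ((z.2 i : ℕ) : ℤ))‖ ^ 2 ≤ (q : ℝ) ^ (2 * s - 1) * ∑ c : Fin q,
      ‖∑ z ∈ (S ×ˢ (Finset.univ : Finset (Fin s → Fin P'))), ev ψ (∑ i, vv k ((z.1 i : ℕ) : ℤ) +
        ∑ i, vv k (((c : ℕ) : ℤ) + (q : ℤ) * ((z.2 i : ℕ) : ℤ)))‖ ^ 2 := by
    intro ψ
    have e1 := sum_prod_ev ψ (s := s) S (fun x => ∑ i, vv k ((x i : ℕ) : ℤ))
      (fun y : Fin (P' * q) => vv k ((y : ℕ) : ℤ))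
    have e2 := fun c : ℤ => sum_prod_ev ψ (s := s) S (fun x => ∑ i, vv k ((x i : ℕ) : ℤ))
      (fun y : Fin P' => vv k (c + (q : ℤ) * ((y : ℕ) : ℤ)))
    simp only [e1, e2]
    have e3 : ∑ y : Fin (P' * q), ev ψ (vv k ((y : ℕ) : ℤ)) = ∑ a : Fin q, ff ψ P' (a : ℕ) q := by
      rw [← ff_split]; simp [ff]
    rw [e3]
    simp only [norm_mul, mul_pow, norm_pow, ← pow_mul, mul_comm s 2]
    have e4 := powmean Finset.univ (fun a : Fin q => ff ψ P' ((a : ℕ) : ℤ) q) (2 * s) (by omega)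
    rw [Finset.card_univ, Fintype.card_fin] at e4
    rw [← Finset.mul_sum, mul_left_comm]
    refine mul_le_mul_of_nonneg_left e4 (by positivity)
  refine (Finset.sum_le_sum fun ψ _ => h3 ψ).trans ?_
  rw [← Finset.mul_sum, Finset.sum_comm]
  simp only [h2]
  have h4 : ∀ c : Fin q, ((L + 1 : ℕ) : ℝ) ^ k * (EC (S ×ˢ (Finset.univ : Finset (Fin s → Fin P')))
      (fun z => ∑ i, vv k ((z.1 i : ℕ) : ℤ) + ∑ i, vv k (((c : ℕ) : ℤ) + (q : ℤ) * ((z.2 i : ℕ) : ℤ))) 0 : ℝ)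
      ≤ ((L + 1 : ℕ) : ℝ) ^ k * (JJ k s P' * (k.factorial * q ^ (k * (k - 1) / 2) * ((P' * q : ℕ) : ℝ) ^ k)) := by
    intro c
    refine mul_le_mul_of_nonneg_left ?_ hLpos.le
    have := good_count k p a q s P' hq hp hkp ha hk hP ((c : ℕ) : ℤ) S hinj
    exact_mod_cast this
  calc (q : ℝ) ^ (2 * s - 1) * ∑ c : Fin q, _ ≤ (q : ℝ) ^ (2 * s - 1) * ∑ c : Fin q,
        ((L + 1 : ℕ) : ℝ) ^ k * (JJ k s P' * (k.factorial * q ^ (k * (k - 1) / 2) * ((P' * q : ℕ) : ℝ) ^ k)) :=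
        mul_le_mul_of_nonneg_left (Finset.sum_le_sum fun c _ => h4 c) (by positivity)
    _ = _ := by
        rw [Finset.sum_const, Finset.card_univ, Fintype.card_fin, nsmul_eq_mul]
        have : (q : ℝ) ^ (2 * s) = (q : ℝ) ^ (2 * s - 1) * q := by
          rw [← pow_succ]; congr 1; omega
        rw [this]; ring

lemma ff_filter {k L : ℕ} (ψ : AddChar (Fin k → ZMod (L + 1)) ℂ) (P q : ℕ) (a : Fin q) :
    ∑ y : Fin (P * q), (if (y : ℕ) % q = a then ev ψ (vv k ((y : ℕ) : ℤ)) else 0) = ff ψ P (a : ℕ) q := by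
  unfold ff
  rw [← finProdFinEquiv.sum_comp, Fintype.sum_prod_type]
  refine Finset.sum_congr rfl fun y _ => ?_
  rw [Finset.sum_eq_single a]
  · simp [finProdFinEquiv, Nat.mod_eq_of_lt a.2]
  · intro b _ hb
    rw [if_neg]
    simp only [finProdFinEquiv, Equiv.coe_fn_mk, Nat.add_mul_mod_self_left, Nat.mod_eq_of_lt b.2]
    intro h; exact hb (Fin.ext h)
  · simp

lemma bad_sum {k L : ℕ} (ψ : AddChar (Fin k → ZMod (L + 1)) ℂ) (P q : ℕ) (hq : 0 < q)
    (i j : Fin k) (hij : i ≠ j) :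
    ∑ x : Fin k → Fin (P * q) with (x i : ℕ) % q = (x j : ℕ) % q, ev ψ (∑ l, vv k ((x l : ℕ) : ℤ)) =
      (∑ a : Fin q, ff ψ P (a : ℕ) q ^ 2) * (ff ψ (P * q) 0 1) ^ (k - 2) := by
  classical
  let h : Fin q → Fin k → Fin (P * q) → ℂ := fun a l y =>
    if l = i ∨ l = j then (if (y : ℕ) % q = a then ev ψ (vv k ((y : ℕ) : ℤ)) else 0)
    else ev ψ (vv k ((y : ℕ) : ℤ))
  have h1 : ∀ (a : Fin q) (x : Fin k → Fin (P * q)), ∏ l, h a l (x l) =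
      if (x i : ℕ) % q = a ∧ (x j : ℕ) % q = a then ∏ l, ev ψ (vv k ((x l : ℕ) : ℤ)) else 0 := by
    intro a x
    split_ifs with hc
    · refine Finset.prod_congr rfl fun l _ => ?_
      simp only [h]
      split_ifs with h2 h3
      · rfl
      · rcases h2 with rfl | rfl
        · exact absurd hc.1 h3
        · exact absurd hc.2 h3
      · rfl
    · by_cases hi : (x i : ℕ) % q = a
      · have hj : ¬ (x j : ℕ) % q = a := fun hj => hc ⟨hi, hj⟩
        exact Finset.prod_eq_zero (Finset.mem_univ j) (by simp [h, hj])
      · exact Finset.prod_eq_zero (Finset.mem_univ i) (by simp [h, hi])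
  have h2 : ∀ x : Fin k → Fin (P * q), (if (x i : ℕ) % q = (x j : ℕ) % q then
      ev ψ (∑ l, vv k ((x l : ℕ) : ℤ)) else 0) = ∑ a : Fin q, ∏ l, h a l (x l) := by
    intro x
    simp only [h1, ev_sum]
    rw [Finset.sum_eq_single (⟨(x i : ℕ) % q, Nat.mod_lt _ hq⟩ : Fin q)]
    · simp only [true_and]
      congr 1
      exact propext eq_comm
    · intro b _ hb
      rw [if_neg]
      rintro ⟨h3, _⟩
      exact hb (Fin.ext h3.symm)
    · simp
  rw [Finset.sum_filter]
  simp only [h2]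
  rw [Finset.sum_comm, Finset.sum_mul]
  refine Finset.sum_congr rfl fun a _ => ?_
  have h3 := (Finset.prod_univ_sum (fun _ : Fin k => (Finset.univ : Finset (Fin (P * q))))
    (fun l y => h a l y)).symm
  rw [Fintype.piFinset_univ] at h3
  rw [h3]
  have h4 : ∀ l, ∑ y, h a l y = if l = i ∨ l = j then ff ψ P (a : ℕ) q else ff ψ (P * q) 0 1 := by
    intro l
    simp only [h]
    split_ifs with hl
    · exact ff_filter ψ P q a
    · simp [ff]
  simp only [h4]
  rw [Finset.prod_ite, Finset.prod_const, Finset.prod_const]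
  have hf : (Finset.univ.filter (fun l : Fin k => l = i ∨ l = j)) = {i, j} := by
    ext l; simp
  have hc : (Finset.univ.filter (fun l : Fin k => l = i ∨ l = j)).card = 2 := by
    rw [hf, Finset.card_pair hij]
  have hc2 := Finset.card_filter_add_card_filter_not (s := (Finset.univ : Finset (Fin k)))
    (fun l : Fin k => l = i ∨ l = j)
  rw [hc, Finset.card_univ, Fintype.card_fin] at hc2
  rw [hc]
  congr 2
  omega

end VK


namespace VK
open Filter

lemma dichot (c a x : ℝ) (hc : 0 ≤ c) (ha : 0 ≤ a) (hx : 0 ≤ x) (t : ℕ) (ht : 2 ≤ t) :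
    c ^ 2 * (a ^ 2 * x ^ (2 * t - 4)) ≤ 1 / 2 * x ^ (2 * t) + (2 * c) ^ t * a ^ t := by
  obtain ⟨m, rfl⟩ : ∃ m, t = m + 2 := ⟨t - 2, by omega⟩
  have e1 : 2 * (m + 2) - 4 = 2 * m := by omega
  rw [e1]
  by_cases h : 2 * (c ^ 2 * a ^ 2) ≤ x ^ 4
  · have h1 : c ^ 2 * (a ^ 2 * x ^ (2 * m)) ≤ 1 / 2 * x ^ (2 * (m + 2)) := by
      have : x ^ (2 * (m + 2)) = x ^ 4 * x ^ (2 * m) := by ring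
      rw [this]
      nlinarith [mul_le_mul_of_nonneg_right h (pow_nonneg hx (2 * m))]
    have : 0 ≤ (2 * c) ^ (m + 2) * a ^ (m + 2) := by positivity
    linarith
  · push Not at h
    have h2 : x ^ 2 ≤ 2 * c * a := by
      apply le_of_sq_le_sq _ (by positivity) <;> nlinarith [sq_nonneg (c * a)]
    have h3 : x ^ (2 * m) ≤ (2 * c * a) ^ m := by
      rw [pow_mul]; exact pow_le_pow_left₀ (by positivity) h2 _
    have h4 : c ^ 2 * (a ^ 2 * x ^ (2 * m)) ≤ c ^ 2 * (a ^ 2 * (2 * c * a) ^ m) := by gcongr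
    have h5 : (2 * c) ^ (m + 2) * a ^ (m + 2) = 4 * (c ^ 2 * (a ^ 2 * (2 * c * a) ^ m)) := by
      rw [mul_pow (2 * c) a m]; ring
    have h6 : 0 ≤ c ^ 2 * (a ^ 2 * (2 * c * a) ^ m) := by positivity
    have : 0 ≤ 1 / 2 * x ^ (2 * (m + 2)) := by positivity
    linarith

lemma step_thm (k p a q s P P1 P' : ℕ) (hp : p.Prime) (hk : 2 ≤ k) (hkp : k < p) (hs : 1 ≤ s)
    (ha : 1 ≤ a) (hq : q = p ^ a) (hP0 : P = P' * q) (hP1 : P = P1 * p) (hP : P ≤ q ^ k) :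
    (JJ k (k + s) P : ℝ) ≤ 2 * k ^ 3 * ((q : ℝ) ^ (2 * s) *
        (JJ k s P' * (k.factorial * q ^ (k * (k - 1) / 2) * P ^ k)))
      + 2 * (2 * (k : ℝ) ^ 2) ^ (k + s) * (p : ℝ) ^ (k + s) * JJ k (k + s) P1 := by
  classical
  set G : ℝ := (q : ℝ) ^ (2 * s) *
        (JJ k s P' * (k.factorial * q ^ (k * (k - 1) / 2) * P ^ k)) with hG
  let w : (Fin k → Fin P) × (Fin s → Fin P) → Fin k → ℤ :=
    fun z => ∑ i, vv k ((z.1 i : ℕ) : ℤ) + ∑ i, vv k ((z.2 i : ℕ) : ℤ)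
  let Sg : Finset (Fin k → Fin P) := Finset.univ.filter
    (fun x => ∀ i j, i ≠ j → ¬ (p : ℤ) ∣ (((x i : ℕ) : ℤ) - ((x j : ℕ) : ℤ)))
  let Sb : Fin k → Fin k → Finset (Fin k → Fin P) := fun i j => Finset.univ.filter
    (fun x => (x i : ℕ) % p = (x j : ℕ) % p)
  let T : Fin k × Fin k → Finset ((Fin k → Fin P) × (Fin s → Fin P)) := fun c =>
    if c.1 = c.2 then Sg ×ˢ Finset.univ else Sb c.1 c.2 ×ˢ Finset.univ
  have hcov := EC_cover (Finset.univ : Finset ((Fin k → Fin P) × (Fin s → Fin P))) w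
    (Finset.univ : Finset (Fin k × Fin k)) T (by
      intro z _
      by_cases hz : z.1 ∈ Sg
      · refine ⟨(⟨0, by omega⟩, ⟨0, by omega⟩), Finset.mem_univ _, ?_⟩
        simp only [T, if_true]
        exact Finset.mem_product.2 ⟨hz, Finset.mem_univ _⟩
      · simp only [Sg, Finset.mem_filter, Finset.mem_univ, true_and] at hz
        push Not at hz
        obtain ⟨i, j, hij, hd⟩ := hz
        refine ⟨(i, j), Finset.mem_univ _, ?_⟩
        simp only [T, hij, if_false]
        refine Finset.mem_product.2 ⟨?_, Finset.mem_univ _⟩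
        simp only [Sb, Finset.mem_filter, Finset.mem_univ, true_and]
        have := Int.emod_eq_emod_iff_emod_sub_eq_zero.2 (Int.emod_eq_zero_of_dvd hd)
        exact_mod_cast this)
  have hgood : (EC (Sg ×ˢ (Finset.univ : Finset (Fin s → Fin P))) w 0 : ℝ) ≤ G := by
    refine good_EC k p a q s P' P hP0 hq hp hkp ha (by omega) hs hP Sg ?_
    intro x hx
    simp only [Sg, Finset.mem_filter, Finset.mem_univ, true_and] at hx
    exact hx
  -- Fourier
  have hev := (orth0 (Finset.univ : Finset ((Fin k → Fin P) × (Fin s → Fin P))) w).and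
    ((JF k (k + s) P 0 1 one_ne_zero).and
    ((Filter.eventually_all.2 fun c : Fin k × Fin k => orth0 (T c) w).and
    (Filter.eventually_all.2 fun b : Fin p => JF k (k + s) P1 ((b : ℕ) : ℤ) p
      (by exact_mod_cast hp.ne_zero))))
  obtain ⟨L, h1, h2, h3, h4⟩ := hev.exists
  set Z : ℝ := ((L + 1 : ℕ) : ℝ) ^ k with hZ
  have hZ0 : 0 < Z := by positivity
  have hsplit : ∀ (ψ : AddChar (Fin k → ZMod (L + 1)) ℂ) (S : Finset (Fin k → Fin P)),
      ∑ z ∈ S ×ˢ (Finset.univ : Finset (Fin s → Fin P)), ev ψ (w z) =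
      (∑ x ∈ S, ev ψ (∑ i, vv k ((x i : ℕ) : ℤ))) * (ff ψ P 0 1) ^ s := by
    intro ψ S
    have := sum_prod_ev ψ (s := s) S (fun x => ∑ i, vv k ((x i : ℕ) : ℤ))
      (fun y : Fin P => vv k ((y : ℕ) : ℤ))
    simpa [ff, w] using this
  have hEJ : (EC (Finset.univ : Finset ((Fin k → Fin P) × (Fin s → Fin P))) w 0 : ℝ) =
      JJ k (k + s) P := by
    have : Z * (EC (Finset.univ : Finset ((Fin k → Fin P) × (Fin s → Fin P))) w 0 : ℝ) =
      Z * JJ k (k + s) P := by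
      rw [← h1, ← h2]
      refine Finset.sum_congr rfl fun ψ _ => ?_
      rw [← Finset.univ_product_univ, hsplit]
      rw [← pow_sum_ev ψ k P (fun y => vv k ((y : ℕ) : ℤ))]
      have : (∑ y : Fin P, ev ψ (vv k ((y : ℕ) : ℤ))) = ff ψ P 0 1 := by simp [ff]
      rw [this, ← pow_add, norm_pow, ← pow_mul, mul_comm (k + s) 2]
      rfl
    exact mul_left_cancel₀ hZ0.ne' this
  let A : AddChar (Fin k → ZMod (L + 1)) ℂ → ℂ := fun ψ => ∑ b : Fin p, ff ψ P1 ((b : ℕ) : ℤ) p ^ 2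
  have hbad : ∀ i j, i ≠ j → Z * (EC (T (i, j)) w 0 : ℝ) =
      ∑ ψ, ‖A ψ‖ ^ 2 * ‖ff ψ P 0 1‖ ^ (2 * (k + s) - 4) := by
    intro i j hij
    rw [← h3 (i, j)]
    refine Finset.sum_congr rfl fun ψ _ => ?_
    simp only [T, hij, if_false]
    rw [hsplit]
    have := bad_sum ψ P1 p hp.pos i j hij
    rw [← hP1] at this
    rw [this, mul_assoc, ← pow_add, norm_mul, norm_pow, mul_pow, ← pow_mul]
    congr 2
    omega
  have hA : ∀ ψ, ‖A ψ‖ ^ (k + s) ≤ (p : ℝ) ^ (k + s - 1) *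
      ∑ b : Fin p, ‖ff ψ P1 ((b : ℕ) : ℤ) p‖ ^ (2 * (k + s)) := by
    intro ψ
    have := powmean Finset.univ (fun b : Fin p => ff ψ P1 ((b : ℕ) : ℤ) p ^ 2) (k + s) (by omega)
    simpa only [Finset.card_univ, Fintype.card_fin, norm_pow, ← pow_mul] using this
  have hcovR : (JJ k (k + s) P : ℝ) ≤ (k : ℝ) ^ 2 * ∑ c : Fin k × Fin k, (EC (T c) w 0 : ℝ) := by
    rw [← hEJ]
    have : ((Finset.univ : Finset (Fin k × Fin k)).card) = k ^ 2 := by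
      simp [sq]
    rw [this] at hcov
    exact_mod_cast hcov
  set Bd : ℝ := ∑ ψ, ‖A ψ‖ ^ 2 * ‖ff ψ P 0 1‖ ^ (2 * (k + s) - 4) with hBd
  have hG0 : 0 ≤ G := by positivity
  have hBd0 : 0 ≤ Bd := Finset.sum_nonneg fun ψ _ => by positivity
  have hsum : Z * ∑ c : Fin k × Fin k, (EC (T c) w 0 : ℝ) ≤ k * (Z * G) + k ^ 2 * Bd := by
    rw [Finset.mul_sum]
    have : ∀ c : Fin k × Fin k, Z * (EC (T c) w 0 : ℝ) ≤ (if c.1 = c.2 then Z * G else 0) + Bd := by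
      rintro ⟨i, j⟩
      by_cases hij : i = j
      · have : T (i, j) = Sg ×ˢ Finset.univ := by simp only [T, hij, if_true]
        rw [this]
        simp only [hij, if_true]
        nlinarith [mul_le_mul_of_nonneg_left hgood hZ0.le]
      · rw [hbad i j hij]
        simp [hij]
    refine (Finset.sum_le_sum fun c _ => this c).trans ?_
    rw [Finset.sum_add_distrib, Fintype.sum_prod_type]
    simp [sq]
  have hBd1 : (k : ℝ) ^ 4 * Bd ≤ 1 / 2 * (Z * JJ k (k + s) P) +
      (2 * (k : ℝ) ^ 2) ^ (k + s) * ((p : ℝ) ^ (k + s) * (Z * JJ k (k + s) P1)) := by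
    have e1 : (p : ℝ) ^ (k + s) * (Z * JJ k (k + s) P1) = (p : ℝ) ^ (k + s - 1) *
        ∑ ψ : AddChar (Fin k → ZMod (L + 1)) ℂ,
          ∑ b : Fin p, ‖ff ψ P1 ((b : ℕ) : ℤ) p‖ ^ (2 * (k + s)) := by
      rw [Finset.sum_comm]
      have : ∀ b : Fin p, ∑ ψ : AddChar (Fin k → ZMod (L + 1)) ℂ,
        ‖ff ψ P1 ((b : ℕ) : ℤ) p‖ ^ (2 * (k + s)) = Z * JJ k (k + s) P1 := fun b => h4 b
      simp only [this, Finset.sum_const, Finset.card_univ, Fintype.card_fin, nsmul_eq_mul]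
      rw [← mul_assoc ((p : ℝ) ^ (k + s - 1)), ← pow_succ, show k + s - 1 + 1 = k + s by omega]
    rw [e1, ← h2, hBd, Finset.mul_sum, Finset.mul_sum, Finset.mul_sum, Finset.mul_sum,
      ← Finset.sum_add_distrib]
    refine Finset.sum_le_sum fun ψ _ => ?_
    have := dichot ((k : ℝ) ^ 2) ‖A ψ‖ ‖ff ψ P 0 1‖ (by positivity) (norm_nonneg _) (norm_nonneg _)
      (k + s) (by omega)
    rw [show ((k : ℝ) ^ 2) ^ 2 = k ^ 4 by ring] at this
    refine this.trans ?_
    have h6 := mul_le_mul_of_nonneg_left (hA ψ) (show (0 : ℝ) ≤ (2 * (k : ℝ) ^ 2) ^ (k + s) by positivity)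
    exact add_le_add le_rfl h6
  have hfin : Z * JJ k (k + s) P ≤ Z * (2 * k ^ 3 * G +
      2 * (2 * (k : ℝ) ^ 2) ^ (k + s) * (p : ℝ) ^ (k + s) * JJ k (k + s) P1) := by
    have h7 := mul_le_mul_of_nonneg_left hcovR hZ0.le
    have h8 := mul_le_mul_of_nonneg_left hsum (show (0 : ℝ) ≤ (k : ℝ) ^ 2 by positivity)
    nlinarith
  exact le_of_mul_le_mul_left hfin hZ0

end VK


namespace VK
open Filter

lemma JJ_triv (k s P : ℕ) : (JJ k s P : ℝ) ≤ (P : ℝ) ^ (2 * s) := by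
  classical
  have : JJ k s P ≤ P ^ (2 * s) := by
    unfold JJ EC
    refine (Finset.card_filter_le _ _).trans ?_
    simp only [Finset.card_product, Finset.card_univ, Fintype.card_fun, Fintype.card_fin]
    rw [← pow_add, two_mul]
  exact_mod_cast this

noncomputable def eta (k r : ℕ) : ℝ := (k * (k + 1) / 2 : ℝ) * (1 - 1 / k) ^ r

lemma eta_nonneg (k r : ℕ) (hk : 1 ≤ k) : 0 ≤ eta k r := by
  unfold eta
  have : (1 : ℝ) ≤ k := by exact_mod_cast hk
  have : 1 / (k : ℝ) ≤ 1 := by rw [div_le_one (by linarith)]; exact this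
  have : 0 ≤ 1 - 1 / (k : ℝ) := by linarith
  positivity

lemma eta_le (k r : ℕ) (hk : 1 ≤ k) : eta k r ≤ k * (k + 1) / 2 := by
  unfold eta
  have : (1 : ℝ) ≤ k := by exact_mod_cast hk
  have h1 : 1 / (k : ℝ) ≤ 1 := by rw [div_le_one (by linarith)]; exact this
  have h0 : 0 < 1 / (k : ℝ) := by positivity
  have : (1 - 1 / (k : ℝ)) ^ r ≤ 1 := pow_le_one₀ (by linarith) (by linarith)
  have h2 : 0 ≤ (k * (k + 1) / 2 : ℝ) := by positivity
  nlinarith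

set_option maxHeartbeats 1000000 in
lemma vino (k p : ℕ) (hp : p.Prime) (hk : 2 ≤ k) (hkp : 16 * k ^ 4 ≤ p) (r : ℕ) : ∀ n : ℕ,
    (JJ k (2 * k ^ 2 + r * k) (p ^ n) : ℝ) ≤ (p : ℝ) ^ (3 * k ^ 2 * r) *
      (p : ℝ) ^ ((n : ℝ) * (2 * (2 * k ^ 2 + r * k) - k * (k + 1) / 2 + eta k r)) := by
  have hkR : (2 : ℝ) ≤ k := by exact_mod_cast hk
  have hk0 : (0 : ℝ) < k := by linarith
  have hpR : (1 : ℝ) < p := by exact_mod_cast hp.one_lt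
  have hp0 : (0 : ℝ) < p := by linarith
  have hkp1 : (16 : ℝ) * k ^ 4 ≤ p := by exact_mod_cast hkp
  have hkp2 : (k : ℝ) ≤ p := by
    have : (k : ℝ) ≤ k ^ 4 := le_self_pow₀ (by linarith) (by norm_num)
    nlinarith
  have hkp3 : k < p := by
    have : k ≤ k ^ 4 := Nat.le_self_pow (by norm_num) k
    omega
  induction r with
  | zero =>
    intro n
    refine (JJ_triv _ _ _).trans ?_
    simp only [eta, Nat.mul_zero, pow_zero, Nat.cast_zero, zero_mul, add_zero, mul_one, one_mul]
    rw [← Real.rpow_natCast, Nat.cast_pow, ← Real.rpow_natCast, ← Real.rpow_mul hp0.le]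
    apply le_of_eq
    congr 1
    push_cast
    ring
  | succ r ih =>
    intro n
    induction n with
    | zero =>
      refine (JJ_triv _ _ _).trans ?_
      simp only [pow_zero, Nat.cast_one, one_pow, Nat.cast_zero, zero_mul, Real.rpow_zero, mul_one]
      exact one_le_pow₀ hpR.le
    | succ n ihn =>
      set s := 2 * k ^ 2 + r * k with hs
      have hs' : 2 * k ^ 2 + (r + 1) * k = k + s := by rw [hs]; ring
      rw [hs'] at ihn ⊢
      set a := n / k + 1 with ha
      have h1 : a ≤ n + 1 := by have := Nat.div_le_self n k; omega
      have h2 : n + 1 ≤ a * k := by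
        have := Nat.lt_div_mul_add (a := n) (b := k) (by omega)
        rw [ha, add_mul]; omega
      have h3 : a * k ≤ n + k := by
        have := Nat.div_mul_le_self n k
        rw [ha, add_mul]; omega
      have hst := step_thm k p a (p ^ a) s (p ^ (n + 1)) (p ^ n) (p ^ (n + 1 - a)) hp hk hkp3
        (by rw [hs]; nlinarith) (by rw [ha]; exact Nat.le_add_left _ _) rfl (by rw [← pow_add]; congr 1; omega) (pow_succ _ _)
        (by rw [← pow_mul]; exact Nat.pow_le_pow_right hp.pos h2)
      refine hst.trans ?_
      have ih1 := ih (n + 1 - a)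
      set E : ℝ := 2 * (2 * k ^ 2 + ((r + 1 : ℕ) : ℝ) * k) - k * (k + 1) / 2 + eta k (r + 1) with hE
      have het : eta k (r + 1) = eta k r * (1 - 1 / k) := by unfold eta; ring
      have hsR : (s : ℝ) = 2 * k ^ 2 + r * k := by rw [hs]; push_cast; ring
      have hEs : E = 2 * (s + k) - k * (k + 1) / 2 + eta k (r + 1) := by
        rw [hE, hsR]; push_cast; ring
      have hna : ((n + 1 - a : ℕ) : ℝ) = n + 1 - a := by
        rw [Nat.cast_sub h1]; push_cast; ring
      rw [← hsR, hna] at ih1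
      have hfact : (k.factorial : ℝ) ≤ (k : ℝ) ^ k := by exact_mod_cast Nat.factorial_le_pow k
      set W : ℝ := (p : ℝ) ^ (3 * k ^ 2 * r) with hW
      have hW0 : 0 < W := by positivity
      set Y : ℝ := (p : ℝ) ^ (((n + 1 : ℕ) : ℝ) * E) with hY
      have hY0 : 0 < Y := by positivity
      have hWW : (p : ℝ) ^ (3 * k ^ 2 * (r + 1)) = W * (p : ℝ) ^ (3 * k ^ 2) := by
        rw [hW, ← pow_add]; ring
      -- good
      have hgood : 2 * (k : ℝ) ^ 3 * (((p ^ a : ℕ) : ℝ) ^ (2 * s) *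
          (JJ k s (p ^ (n + 1 - a)) * (k.factorial * ((p ^ a : ℕ) : ℝ) ^ (k * (k - 1) / 2) *
            ((p ^ (n + 1) : ℕ) : ℝ) ^ k))) ≤ 1 / 2 * (W * (p : ℝ) ^ (3 * k ^ 2) * Y) := by
        have g1 : ((p ^ a : ℕ) : ℝ) ^ (2 * s) * ((W * (p : ℝ) ^ ((n + 1 - a) *
            (2 * (s : ℝ) - k * (k + 1) / 2 + eta k r))) * (((p ^ a : ℕ) : ℝ) ^ (k * (k - 1) / 2) *
            ((p ^ (n + 1) : ℕ) : ℝ) ^ k)) ≤ W * ((p : ℝ) ^ (k ^ 2) * Y) := by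
          have e1 : ((p ^ a : ℕ) : ℝ) ^ (2 * s) = (p : ℝ) ^ ((a : ℝ) * (2 * s)) := by
            rw [Nat.cast_pow, ← pow_mul, ← Real.rpow_natCast]; push_cast; rfl
          have e2 : ((p ^ a : ℕ) : ℝ) ^ (k * (k - 1) / 2) = (p : ℝ) ^ ((a : ℝ) * (k * (k - 1) / 2)) := by
            rw [Nat.cast_pow, ← pow_mul, ← Real.rpow_natCast]
            congr 1
            push_cast
            rw [Nat.cast_div (Nat.even_mul_pred_self k).two_dvd (by norm_num)]
            push_cast
            rw [Nat.cast_sub (by omega)]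
            push_cast; rfl
          have e3 : ((p ^ (n + 1) : ℕ) : ℝ) ^ k = (p : ℝ) ^ (((n : ℝ) + 1) * k) := by
            rw [Nat.cast_pow, ← pow_mul, ← Real.rpow_natCast]; push_cast; rfl
          have e4 : (p : ℝ) ^ (k ^ 2) = (p : ℝ) ^ ((k : ℝ) ^ 2) := by
            rw [← Real.rpow_natCast]; push_cast; rfl
          rw [e1, e2, e3, e4, hY]
          have : ∀ A B C D : ℝ, A * ((W * B) * (C * D)) = W * (A * (B * (C * D))) := by intros; ring
          rw [this]
          refine mul_le_mul_of_nonneg_left ?_ hW0.le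
          rw [← Real.rpow_add hp0, ← Real.rpow_add hp0, ← Real.rpow_add hp0, ← Real.rpow_add hp0]
          refine Real.rpow_le_rpow_of_exponent_le hpR.le ?_
          rw [hEs, het]
          push_cast
          have h3R : (a : ℝ) * k ≤ n + k := by exact_mod_cast h3
          have hη := eta_le k r (by omega)
          have hη0 := eta_nonneg k r (by omega)
          set η := eta k r
          have hx : (a : ℝ) ≤ (n + k) / k := by rw [le_div_iff₀ hk0]; exact h3R
          have hy : 0 ≤ (k : ℝ) ^ 2 - η := by nlinarith
          have hz : (a : ℝ) * (k ^ 2 - η) ≤ (n + k) / k * (k ^ 2 - η) :=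
            mul_le_mul_of_nonneg_right hx hy
          have hz2 : ((n : ℝ) + k) / k * (k ^ 2 - η) = (n + k) * k - n * (η * (1 / k)) - η := by
            field_simp
            ring
          have hz3 : 0 ≤ η * (1 / k) := by positivity
          have hz4 : η * (1 / k) ≤ η := by
            have : 1 / (k : ℝ) ≤ 1 := by rw [div_le_one hk0]; linarith
            nlinarith
          have hz5 : η * (1 - 1 / (k : ℝ)) = η - η * (1 / k) := by ring
          rw [hz5]
          rw [hz2] at hz
          generalize η * (1 / (k : ℝ)) = w at *
          have f1 : (a : ℝ) * (2 * s) + (((n : ℝ) + 1 - a) * (2 * s - k * (k + 1) / 2 + η) +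
            (a * (k * (k - 1) / 2) + (n + 1) * k)) =
            (n + 1) * (2 * s - k * (k + 1) / 2 + η + k) + a * (k ^ 2 - η) := by ring
          rw [f1]
          have f2 : (k : ℝ) ^ 2 + (n + 1) * (2 * (s + k) - k * (k + 1) / 2 + (η - w)) =
            (n + 1) * (2 * s - k * (k + 1) / 2 + η + k) + ((n + k) * k - n * w - η) + (k + η - w) := by
            ring
          rw [f2]
          linarith
        have g2 : 4 * (k : ℝ) ^ 3 * k.factorial * (p : ℝ) ^ (k ^ 2) ≤ (p : ℝ) ^ (3 * k ^ 2) := by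
          have : 4 * (k : ℝ) ^ 3 ≤ p := by nlinarith [pow_pos hk0 3, pow_pos hk0 4]
          have h5 : (k.factorial : ℝ) ≤ (p : ℝ) ^ k := hfact.trans (pow_le_pow_left₀ hk0.le hkp2 _)
          calc 4 * (k : ℝ) ^ 3 * k.factorial * (p : ℝ) ^ (k ^ 2) ≤ p * (p : ℝ) ^ k * (p : ℝ) ^ (k ^ 2) := by
                gcongr
            _ = (p : ℝ) ^ (1 + k + k ^ 2) := by ring
            _ ≤ _ := pow_le_pow_right₀ hpR.le (by nlinarith)
        calc _ ≤ 2 * (k : ℝ) ^ 3 * (((p ^ a : ℕ) : ℝ) ^ (2 * s) *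
              ((W * (p : ℝ) ^ ((n + 1 - a) * (2 * (s : ℝ) - k * (k + 1) / 2 + eta k r))) *
              (k.factorial * ((p ^ a : ℕ) : ℝ) ^ (k * (k - 1) / 2) *
              ((p ^ (n + 1) : ℕ) : ℝ) ^ k))) := by gcongr
          _ = 2 * (k : ℝ) ^ 3 * k.factorial * (((p ^ a : ℕ) : ℝ) ^ (2 * s) * ((W * (p : ℝ) ^ ((n + 1 - a) *
              (2 * (s : ℝ) - k * (k + 1) / 2 + eta k r))) * (((p ^ a : ℕ) : ℝ) ^ (k * (k - 1) / 2) *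
            ((p ^ (n + 1) : ℕ) : ℝ) ^ k))) := by ring
          _ ≤ 2 * (k : ℝ) ^ 3 * k.factorial * (W * ((p : ℝ) ^ (k ^ 2) * Y)) := by gcongr
          _ = 1 / 2 * (4 * (k : ℝ) ^ 3 * k.factorial * (p : ℝ) ^ (k ^ 2)) * (W * Y) := by ring
          _ ≤ 1 / 2 * (p : ℝ) ^ (3 * k ^ 2) * (W * Y) := by gcongr
          _ = _ := by ring
      have hbad : 2 * (2 * (k : ℝ) ^ 2) ^ (k + s) * (p : ℝ) ^ (k + s) * JJ k (k + s) (p ^ n)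
          ≤ 1 / 2 * (W * (p : ℝ) ^ (3 * k ^ 2) * Y) := by
        rw [hWW] at ihn
        have b1 : 4 * (2 * (k : ℝ) ^ 2) ^ (k + s) * (p : ℝ) ^ (k + s) ≤ (p : ℝ) ^ E := by
          obtain ⟨K, hK⟩ : ∃ K, k * (k + 1) = 2 * K := (Nat.even_mul_succ_self k).two_dvd
          have hKR : (k : ℝ) * (k + 1) = 2 * K := by exact_mod_cast hK
          have hKs : 2 * K ≤ k + s := by rw [← hK, hs]; nlinarith
          have c1 : (p : ℝ) ^ ((k + s - K) + (k + s)) ≤ (p : ℝ) ^ E := by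
            rw [← Real.rpow_natCast]
            refine Real.rpow_le_rpow_of_exponent_le hpR.le ?_
            have := eta_nonneg k (r + 1) (by omega)
            rw [hEs, hKR]
            push_cast [Nat.cast_sub (show K ≤ k + s by omega)]
            linarith
          refine le_trans ?_ c1
          rw [pow_add (p : ℝ) (k + s - K)]
          refine mul_le_mul_of_nonneg_right ?_ (by positivity)
          calc 4 * (2 * (k : ℝ) ^ 2) ^ (k + s) ≤ 2 ^ (k + s) * (2 * (k : ℝ) ^ 2) ^ (k + s) := by
                gcongr
                calc (4 : ℝ) = 2 ^ 2 := by norm_num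
                  _ ≤ _ := pow_le_pow_right₀ (by norm_num) (by omega)
            _ = (4 * (k : ℝ) ^ 2) ^ (k + s) := by rw [← mul_pow]; ring
            _ ≤ (4 * (k : ℝ) ^ 2) ^ (2 * (k + s - K)) :=
                pow_le_pow_right₀ (by nlinarith) (by omega)
            _ = (16 * (k : ℝ) ^ 4) ^ (k + s - K) := by rw [pow_mul]; ring
            _ ≤ _ := by gcongr
        have hYY : Y = (p : ℝ) ^ E * (p : ℝ) ^ ((n : ℝ) * E) := by
          rw [hY, ← Real.rpow_add hp0]; congr 1; push_cast; ring
        calc _ ≤ 2 * (2 * (k : ℝ) ^ 2) ^ (k + s) * (p : ℝ) ^ (k + s) *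
              (W * (p : ℝ) ^ (3 * k ^ 2) * (p : ℝ) ^ ((n : ℝ) * E)) := by gcongr
          _ = 1 / 2 * (4 * (2 * (k : ℝ) ^ 2) ^ (k + s) * (p : ℝ) ^ (k + s)) *
              (W * (p : ℝ) ^ (3 * k ^ 2) * (p : ℝ) ^ ((n : ℝ) * E)) := by ring
          _ ≤ 1 / 2 * (p : ℝ) ^ E * (W * (p : ℝ) ^ (3 * k ^ 2) * (p : ℝ) ^ ((n : ℝ) * E)) := by gcongr
          _ = _ := by rw [hYY]; ring
      rw [hWW]
      linarith

end VK


namespace VK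
open Filter

/-- `e(x)` -/
noncomputable def ee (x : ℝ) : ℂ := Complex.exp (((2 * Real.pi * x : ℝ) : ℂ) * Complex.I)

lemma ee_add (x y : ℝ) : ee (x + y) = ee x * ee y := by
  unfold ee; rw [← Complex.exp_add]; congr 1; push_cast; ring

lemma norm_ee (x : ℝ) : ‖ee x‖ = 1 := Complex.norm_exp_ofReal_mul_I _

lemma ee_zero : ee 0 = 1 := by simp [ee]

lemma ee_neg (x : ℝ) : ee (-x) = (starRingEnd ℂ) (ee x) := by
  unfold ee
  rw [← Complex.exp_conj, map_mul, Complex.conj_I, Complex.conj_ofReal]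
  congr 1; push_cast; ring

lemma ee_sum {ι : Type*} (s : Finset ι) (v : ι → ℝ) : ee (∑ i ∈ s, v i) = ∏ i ∈ s, ee (v i) := by
  classical
  induction s using Finset.induction_on with
  | empty => simp [ee_zero]
  | insert a s ha ih => rw [Finset.sum_insert ha, Finset.prod_insert ha, ee_add, ih]

noncomputable def dot {k : ℕ} (β : Fin k → ℝ) (v : Fin k → ℤ) : ℝ := ∑ j, β j * (v j : ℝ)

lemma dot_add {k : ℕ} (β : Fin k → ℝ) (v w : Fin k → ℤ) : dot β (v + w) = dot β v + dot β w := by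
  unfold dot; rw [← Finset.sum_add_distrib]
  refine Finset.sum_congr rfl fun j _ => ?_
  simp [mul_add]

lemma dot_neg {k : ℕ} (β : Fin k → ℝ) (v : Fin k → ℤ) : dot β (-v) = -dot β v := by
  unfold dot; rw [← Finset.sum_neg_distrib]
  refine Finset.sum_congr rfl fun j _ => ?_
  simp

lemma dot_sum {k : ℕ} {ι : Type*} (β : Fin k → ℝ) (s : Finset ι) (v : ι → Fin k → ℤ) :
    dot β (∑ i ∈ s, v i) = ∑ i ∈ s, dot β (v i) := by
  unfold dot
  rw [Finset.sum_comm]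
  refine Finset.sum_congr rfl fun j _ => ?_
  simp [Finset.sum_apply, Finset.mul_sum]

/-- sum of moment vectors -/
def WW (k l X : ℕ) (x : Fin l → Fin X) : Fin k → ℤ := ∑ i, vv k ((x i : ℕ) : ℤ)

lemma expand {k : ℕ} (β : Fin k → ℝ) (l X : ℕ) :
    ((‖∑ y : Fin X, ee (dot β (vv k ((y : ℕ) : ℤ)))‖ ^ (2 * l) : ℝ) : ℂ) =
      ∑ z : (Fin l → Fin X) × (Fin l → Fin X), ee (dot β (WW k l X z.1 - WW k l X z.2)) := by
  have h1 : (∑ y : Fin X, ee (dot β (vv k ((y : ℕ) : ℤ)))) ^ l =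
      ∑ x : Fin l → Fin X, ee (dot β (WW k l X x)) := by
    rw [Fintype.sum_pow (fun y : Fin X => ee (dot β (vv k ((y : ℕ) : ℤ)))) l]
    refine Finset.sum_congr rfl fun x _ => ?_
    rw [WW, dot_sum, ee_sum]
  rw [mul_comm 2 l, pow_mul, ← norm_pow, h1]
  have : ∀ Z : ℂ, ((‖Z‖ ^ 2 : ℝ) : ℂ) = Z * (starRingEnd ℂ) Z := by
    intro Z; rw [Complex.mul_conj, Complex.normSq_eq_norm_sq]
  rw [this, map_sum, Finset.sum_mul_sum, ← Finset.sum_product', Finset.univ_product_univ]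
  refine Finset.sum_congr rfl fun z _ => ?_
  rw [← ee_neg, ← ee_add, sub_eq_add_neg, dot_add, dot_neg]

noncomputable def Bx (k l X : ℕ) : Finset (Fin k → ℤ) :=
  Fintype.piFinset (fun j : Fin k => Finset.Icc (-((l * X ^ (j.val + 1) : ℕ) : ℤ)) ((l * X ^ (j.val + 1) : ℕ) : ℤ))

lemma WW_mem (k l X : ℕ) (z : (Fin l → Fin X) × (Fin l → Fin X)) :
    WW k l X z.1 - WW k l X z.2 ∈ Bx k l X := by
  have h : ∀ (x : Fin l → Fin X) (j : Fin k), 0 ≤ WW k l X x j ∧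
      WW k l X x j ≤ ((l * X ^ (j.val + 1) : ℕ) : ℤ) := by
    intro x j
    simp only [WW, Finset.sum_apply, vv]
    constructor
    · exact Finset.sum_nonneg fun i _ => by positivity
    · have : ∀ i ∈ Finset.univ, (((x i : ℕ) : ℤ)) ^ (j.val + 1) ≤ ((X ^ (j.val + 1) : ℕ) : ℤ) := by
        intro i _
        have := Nat.pow_le_pow_left (x i).2.le (j.val + 1)
        exact_mod_cast this
      refine (Finset.sum_le_sum this).trans ?_
      simp
  rw [Bx, Fintype.mem_piFinset]
  intro j
  rw [Finset.mem_Icc]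
  have h1 := h z.1 j
  have h2 := h z.2 j
  simp only [Pi.sub_apply]
  constructor <;> linarith [h1.1, h1.2, h2.1, h2.2]

lemma fibre (k l X : ℕ) (h : (Fin k → ℤ) → ℝ) (h0 : ∀ v, 0 ≤ h v) :
    ∑ z : (Fin l → Fin X) × (Fin l → Fin X), h (WW k l X z.1 - WW k l X z.2) ≤
      JJ k l X * ∑ v ∈ Bx k l X, h v := by
  classical
  rw [← Finset.sum_fiberwise_of_maps_to (s := Finset.univ) (t := Bx k l X)
    (g := fun z : (Fin l → Fin X) × (Fin l → Fin X) => WW k l X z.1 - WW k l X z.2)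
    (fun z _ => WW_mem k l X z), Finset.mul_sum]
  refine Finset.sum_le_sum fun v _ => ?_
  have h1 : ∑ z ∈ Finset.univ.filter (fun z : (Fin l → Fin X) × (Fin l → Fin X) =>
      WW k l X z.1 - WW k l X z.2 = v), h (WW k l X z.1 - WW k l X z.2) =
      (Finset.univ.filter (fun z : (Fin l → Fin X) × (Fin l → Fin X) =>
      WW k l X z.1 - WW k l X z.2 = v)).card * h v := by
    rw [← nsmul_eq_mul, ← Finset.sum_const]
    refine Finset.sum_congr rfl fun z hz => ?_
    rw [(Finset.mem_filter.1 hz).2]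
  rw [h1]
  refine mul_le_mul_of_nonneg_right ?_ (h0 v)
  have h2 := EC_le (Finset.univ : Finset (Fin l → Fin X)) (WW k l X) v
  have h3 : EC (Finset.univ : Finset (Fin l → Fin X)) (WW k l X) 0 = JJ k l X := rfl
  rw [h3] at h2
  have h4 : (Finset.univ.filter (fun z : (Fin l → Fin X) × (Fin l → Fin X) =>
      WW k l X z.1 - WW k l X z.2 = v)).card = EC (Finset.univ : Finset (Fin l → Fin X)) (WW k l X) v := by
    unfold EC
    rw [Finset.univ_product_univ]
  rw [h4]
  exact_mod_cast h2

noncomputable def BB (α : ℝ) (H : ℕ) : ℝ :=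
  ∑ μ ∈ Finset.Icc (-(H : ℤ)) H, ‖∑ lam ∈ Finset.Icc (-(H : ℤ)) H, ee (α * lam * μ)‖

lemma box_sum {k : ℕ} (l X : ℕ) (α : Fin k → ℝ) :
    ∑ μ ∈ Bx k l X, ‖∑ lam ∈ Bx k l X, ee (∑ j, α j * (lam j : ℝ) * (μ j : ℝ))‖ =
      ∏ j : Fin k, BB (α j) (l * X ^ (j.val + 1)) := by
  classical
  simp only [BB]
  rw [Finset.prod_univ_sum]
  refine Finset.sum_congr rfl fun μ _ => ?_
  rw [← norm_prod, Finset.prod_univ_sum]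
  simp only [ee_sum]
  rfl

lemma bilinear {k : ℕ} (l X : ℕ) (hl : 1 ≤ l) (α : Fin k → ℝ) :
    ‖∑ x : Fin X, ∑ y : Fin X, ee (∑ j : Fin k, α j * (x : ℝ) ^ (j.val + 1) * (y : ℝ) ^ (j.val + 1))‖
      ^ (4 * l ^ 2) ≤ (X : ℝ) ^ (8 * l ^ 2 - 4 * l) * (JJ k l X : ℝ) ^ 2 *
        ∏ j : Fin k, BB (α j) (l * X ^ (j.val + 1)) := by
  classical
  set V := ∑ x : Fin X, ∑ y : Fin X, ee (∑ j : Fin k, α j * (x : ℝ) ^ (j.val + 1) * (y : ℝ) ^ (j.val + 1)) with hV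
  let g : (Fin k → ℤ) → ℂ := fun lam => ∑ x : Fin X,
    ee (dot (fun j => α j * (lam j : ℝ)) (vv k ((x : ℕ) : ℤ)))
  have e1 : ∀ x : Fin X, ∑ y : Fin X,
      ee (∑ j : Fin k, α j * (x : ℝ) ^ (j.val + 1) * (y : ℝ) ^ (j.val + 1)) =
      ∑ y : Fin X, ee (dot (fun j => α j * (x : ℝ) ^ (j.val + 1)) (vv k ((y : ℕ) : ℤ))) := by
    intro x; simp [dot, vv]
  have s1 : ‖V‖ ^ (2 * l) ≤ (X : ℝ) ^ (2 * l - 1) *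
      ∑ z : (Fin l → Fin X) × (Fin l → Fin X), ‖g (WW k l X z.1 - WW k l X z.2)‖ := by
    have := powmean Finset.univ (fun x : Fin X => ∑ y : Fin X,
      ee (∑ j : Fin k, α j * (x : ℝ) ^ (j.val + 1) * (y : ℝ) ^ (j.val + 1))) (2 * l) (by omega)
    rw [Finset.card_univ, Fintype.card_fin] at this
    refine this.trans (mul_le_mul_of_nonneg_left ?_ (by positivity))
    have e2 : ((∑ x : Fin X, ‖∑ y : Fin X, ee (∑ j : Fin k, α j * (x : ℝ) ^ (j.val + 1) *
        (y : ℝ) ^ (j.val + 1))‖ ^ (2 * l) : ℝ) : ℂ) =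
        ∑ z : (Fin l → Fin X) × (Fin l → Fin X), g (WW k l X z.1 - WW k l X z.2) := by
      rw [Complex.ofReal_sum]
      simp only [e1, expand, g]
      rw [Finset.sum_comm]
      refine Finset.sum_congr rfl fun z _ => Finset.sum_congr rfl fun x _ => ?_
      congr 1
      unfold dot
      refine Finset.sum_congr rfl fun j _ => ?_
      simp only [vv]
      push_cast
      ring
    have e3 := congrArg norm e2
    rw [Complex.norm_real, Real.norm_of_nonneg (Finset.sum_nonneg fun _ _ => by positivity)] at e3
    rw [e3]
    exact norm_sum_le _ _
  have s2 : ∑ v ∈ Bx k l X, ‖g v‖ ^ (2 * l) ≤ JJ k l X * ∏ j : Fin k, BB (α j) (l * X ^ (j.val + 1)) := by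
    have e2 : ((∑ v ∈ Bx k l X, ‖g v‖ ^ (2 * l) : ℝ) : ℂ) =
        ∑ z : (Fin l → Fin X) × (Fin l → Fin X),
          ∑ v ∈ Bx k l X, ee (∑ j, α j * (v j : ℝ) * ((WW k l X z.1 - WW k l X z.2) j : ℝ)) := by
      rw [Complex.ofReal_sum]
      simp only [g, expand]
      rw [Finset.sum_comm]
      rfl
    have e3 := congrArg norm e2
    rw [Complex.norm_real, Real.norm_of_nonneg (Finset.sum_nonneg fun _ _ => by positivity)] at e3
    rw [e3]
    refine (norm_sum_le _ _).trans ?_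
    refine (fibre k l X (fun μ => ‖∑ v ∈ Bx k l X, ee (∑ j, α j * (v j : ℝ) * (μ j : ℝ))‖)
      (fun _ => norm_nonneg _)).trans ?_
    rw [box_sum]
  have s3 : (∑ z : (Fin l → Fin X) × (Fin l → Fin X), ‖g (WW k l X z.1 - WW k l X z.2)‖) ^ (2 * l) ≤
      ((X : ℝ) ^ (2 * l)) ^ (2 * l - 1) *
        (JJ k l X * (JJ k l X * ∏ j : Fin k, BB (α j) (l * X ^ (j.val + 1)))) := by
    have := powmean Finset.univ (fun z : (Fin l → Fin X) × (Fin l → Fin X) =>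
      ((‖g (WW k l X z.1 - WW k l X z.2)‖ : ℝ) : ℂ)) (2 * l) (by omega)
    rw [← Complex.ofReal_sum, Complex.norm_real,
      Real.norm_of_nonneg (Finset.sum_nonneg fun _ _ => norm_nonneg _)] at this
    simp only [Complex.norm_real, norm_norm] at this
    have hc : ((Finset.univ : Finset ((Fin l → Fin X) × (Fin l → Fin X))).card : ℝ) = (X : ℝ) ^ (2 * l) := by
      rw [Finset.card_univ, Fintype.card_prod, Fintype.card_fun, Fintype.card_fin, Fintype.card_fin]
      push_cast; ring
    rw [hc] at this
    refine this.trans (mul_le_mul_of_nonneg_left ?_ (by positivity))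
    refine (fibre k l X (fun v => ‖g v‖ ^ (2 * l)) (fun _ => by positivity)).trans ?_
    exact mul_le_mul_of_nonneg_left s2 (by positivity)
  calc ‖V‖ ^ (4 * l ^ 2) = (‖V‖ ^ (2 * l)) ^ (2 * l) := by rw [← pow_mul]; congr 1; ring
    _ ≤ ((X : ℝ) ^ (2 * l - 1) *
      ∑ z : (Fin l → Fin X) × (Fin l → Fin X), ‖g (WW k l X z.1 - WW k l X z.2)‖) ^ (2 * l) :=
        pow_le_pow_left₀ (by positivity) s1 _
    _ = ((X : ℝ) ^ (2 * l - 1)) ^ (2 * l) *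
      (∑ z : (Fin l → Fin X) × (Fin l → Fin X), ‖g (WW k l X z.1 - WW k l X z.2)‖) ^ (2 * l) := mul_pow _ _ _
    _ ≤ ((X : ℝ) ^ (2 * l - 1)) ^ (2 * l) * (((X : ℝ) ^ (2 * l)) ^ (2 * l - 1) *
        (JJ k l X * (JJ k l X * ∏ j : Fin k, BB (α j) (l * X ^ (j.val + 1))))) :=
        mul_le_mul_of_nonneg_left s3 (by positivity)
    _ = ((X : ℝ) ^ (2 * l - 1)) ^ (2 * l) * ((X : ℝ) ^ (2 * l)) ^ (2 * l - 1) * ((JJ k l X : ℝ) ^ 2 *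
        ∏ j : Fin k, BB (α j) (l * X ^ (j.val + 1))) := by ring
    _ = _ := by
      rw [← pow_mul, ← pow_mul, ← pow_add, ← mul_assoc]
      congr 3
      obtain ⟨m, rfl⟩ : ∃ m, l = m + 1 := ⟨l - 1, by omega⟩
      have : 8 * (m + 1) ^ 2 = (2 * (m + 1) - 1) * (2 * (m + 1)) + 2 * (m + 1) * (2 * (m + 1) - 1) + 4 * (m + 1) := by
        rw [show 2 * (m + 1) - 1 = 2 * m + 1 by omega]; ring
      rw [this, Nat.add_sub_cancel]

end VK


namespace VK
open Filter

lemma ee_int (m : ℤ) : ee m = 1 := by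
  unfold ee
  rw [Complex.exp_eq_one_iff]
  exact ⟨m, by push_cast; ring⟩

lemma ee_sub_one (θ : ℝ) : 4 * |θ - round θ| ≤ ‖ee θ - 1‖ := by
  set x := θ - round θ with hx
  have h1 : ee θ = ee x := by
    have : θ = x + (round θ : ℤ) := by rw [hx]; ring
    rw [this, ee_add, ee_int, mul_one]
  have h2 : |x| ≤ 1 / 2 := abs_sub_round θ
  rw [h1]
  unfold ee
  have h3 := Complex.norm_exp_I_mul_ofReal_sub_one (2 * Real.pi * x)
  rw [mul_comm Complex.I] at h3
  rw [h3, norm_mul, Real.norm_eq_abs, Real.norm_eq_abs, show 2 * Real.pi * x / 2 = Real.pi * x by ring]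
  have h4 : 2 * |x| ≤ |Real.sin (Real.pi * x)| := by
    have := Real.mul_le_sin (x := Real.pi * |x|) (by positivity) (by nlinarith [Real.pi_pos])
    have e : 2 / Real.pi * (Real.pi * |x|) = 2 * |x| := by field_simp
    rw [e] at this
    refine this.trans ?_
    rcases abs_cases x with ⟨h, _⟩ | ⟨h, _⟩ <;> rw [h]
    · exact le_abs_self _
    · rw [mul_neg, Real.sin_neg]; exact neg_le_abs _
  rw [abs_of_pos (by norm_num : (0 : ℝ) < 2)]
  linarith

lemma geom (θ : ℝ) (H : ℕ) : (ee θ - 1) * ∑ lam ∈ Finset.Icc (-(H : ℤ)) H, ee (θ * lam) =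
    ee (θ * (H + 1)) - ee (-(θ * H)) := by
  induction H with
  | zero => simp [ee_zero]
  | succ H ih =>
    have hI : Finset.Icc (-((H + 1 : ℕ) : ℤ)) ((H + 1 : ℕ) : ℤ) =
        insert ((H + 1 : ℕ) : ℤ) (insert (-((H + 1 : ℕ) : ℤ)) (Finset.Icc (-(H : ℤ)) H)) := by
      ext m; simp only [Finset.mem_insert, Finset.mem_Icc]; push_cast; omega
    rw [hI, Finset.sum_insert (by simp only [Finset.mem_insert, Finset.mem_Icc]; push_cast; omega),
      Finset.sum_insert (by simp only [Finset.mem_Icc]; push_cast; omega), mul_add, mul_add, ih,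
      sub_mul, sub_mul, ← ee_add, ← ee_add]
    push_cast
    rw [show θ + θ * ((H : ℝ) + 1) = θ * ((H : ℝ) + 1 + 1) by ring,
      show θ + θ * -((H : ℝ) + 1) = -(θ * H) by ring,
      show θ * -((H : ℝ) + 1) = -(θ * (H + 1)) by ring]
    ring

lemma geom_le (θ : ℝ) (H : ℕ) (δ : ℝ) (hδ : 0 < δ) (h : δ ≤ |θ - round θ|) :
    ‖∑ lam ∈ Finset.Icc (-(H : ℤ)) H, ee (θ * lam)‖ ≤ 1 / (2 * δ) := by
  have h1 := congrArg norm (geom θ H)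
  rw [norm_mul] at h1
  have h2 : ‖ee (θ * (H + 1)) - ee (-(θ * H))‖ ≤ 2 := by
    refine (norm_sub_le _ _).trans ?_
    rw [norm_ee, norm_ee]; norm_num
  have h3 := ee_sub_one θ
  rw [le_div_iff₀ (by positivity)]
  nlinarith [norm_nonneg (∑ lam ∈ Finset.Icc (-(H : ℤ)) H, ee (θ * lam))]

lemma card_int (S : Finset ℤ) (x y : ℝ) (hxy : x ≤ y) (h : ∀ m ∈ S, x ≤ (m : ℝ) ∧ (m : ℝ) ≤ y) :
    (S.card : ℝ) ≤ y - x + 1 := by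
  have h1 : S ⊆ Finset.Icc ⌈x⌉ ⌊y⌋ := by
    intro m hm
    rw [Finset.mem_Icc]
    exact ⟨Int.ceil_le.2 (h m hm).1, Int.le_floor.2 (h m hm).2⟩
  have h2 := Finset.card_le_card h1
  rw [Int.card_Icc] at h2
  have h3 : ((⌊y⌋ + 1 - ⌈x⌉).toNat : ℝ) ≤ y - x + 1 := by
    rcases le_total 0 (⌊y⌋ + 1 - ⌈x⌉) with h0 | h0
    · have : (((⌊y⌋ + 1 - ⌈x⌉).toNat : ℤ) : ℝ) = ((⌊y⌋ + 1 - ⌈x⌉ : ℤ) : ℝ) := by rw [Int.toNat_of_nonneg h0]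
      rw [Int.cast_natCast] at this
      rw [this]
      push_cast
      linarith [Int.floor_le y, Int.le_ceil x]
    · rw [Int.toNat_of_nonpos h0]; push_cast; linarith
  exact (by exact_mod_cast h2 : (S.card : ℝ) ≤ ((⌊y⌋ + 1 - ⌈x⌉).toNat : ℝ)).trans h3

lemma BB_est (α Q δ : ℝ) (H : ℕ) (hQ : 0 < Q) (hα : |α| = 1 / Q) (hδ : 0 < δ) :
    BB α H ≤ (2 * H + 1) * ((2 * H / Q + 3) * (2 * δ * Q + 1) + 1 / (2 * δ)) := by
  classical
  set I := Finset.Icc (-(H : ℤ)) H with hI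
  have hIc : (I.card : ℝ) = 2 * H + 1 := by
    rw [hI, Int.card_Icc]
    have : ((H : ℤ) + 1 - -(H : ℤ)).toNat = 2 * H + 1 := by omega
    rw [this]; push_cast; ring
  set S := I.filter (fun μ : ℤ => |α * μ - round (α * μ)| < δ) with hS
  have hα0 : α ≠ 0 := by
    intro h; rw [h, abs_zero] at hα; have : 0 < 1 / Q := by positivity
    linarith
  have hcard : (S.card : ℝ) ≤ (2 * H / Q + 3) * (2 * δ * Q + 1) := by
    have h1 := Finset.card_le_mul_card_image (f := fun μ : ℤ => round (α * μ)) S ⌊2 * δ * Q + 1⌋₊ (by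
      intro m _
      apply Nat.le_floor
      have := card_int (S.filter (fun μ : ℤ => round (α * μ) = m)) (m / α - δ * Q) (m / α + δ * Q)
        (by nlinarith [mul_pos hδ hQ]) (by
          intro μ hμ
          rw [Finset.mem_filter, hS, Finset.mem_filter] at hμ
          obtain ⟨⟨_, h2⟩, h3⟩ := hμ
          rw [h3] at h2
          have h4 : |(μ : ℝ) - m / α| ≤ δ * Q := by
            have : (μ : ℝ) - m / α = (α * μ - m) / α := by field_simp
            rw [this, abs_div, hα, div_div_eq_mul_div, div_one]
            nlinarith
          rw [abs_le] at h4
          constructor <;> linarith [h4.1, h4.2])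
      linarith)
    have h2 : ((S.image (fun μ : ℤ => round (α * μ))).card : ℝ) ≤ 2 * H / Q + 3 := by
      have := card_int (S.image (fun μ : ℤ => round (α * μ))) (-(H / Q + 1 / 2)) (H / Q + 1 / 2)
        (by have : 0 ≤ (H : ℝ) / Q := by positivity
            linarith) (by
          intro m hm
          rw [Finset.mem_image] at hm
          obtain ⟨μ, hμ, rfl⟩ := hm
          rw [hS, Finset.mem_filter, hI, Finset.mem_Icc] at hμ
          have h3 := abs_sub_round (α * μ)
          have h4 : |α * μ| ≤ H / Q := by
            rw [abs_mul, hα, one_div, inv_mul_eq_div]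
            have : |(μ : ℝ)| ≤ H := by
              rw [abs_le]
              exact ⟨by exact_mod_cast hμ.1.1, by exact_mod_cast hμ.1.2⟩
            gcongr
          rw [abs_le] at h3 h4
          constructor <;> linarith [h3.1, h3.2, h4.1, h4.2])
      have e : 2 * (H : ℝ) / Q = 2 * (H / Q) := by ring
      linarith
    calc (S.card : ℝ) ≤ ((⌊2 * δ * Q + 1⌋₊ * (S.image (fun μ : ℤ => round (α * μ))).card : ℕ) : ℝ) := by
          exact_mod_cast h1
      _ ≤ (2 * δ * Q + 1) * (2 * H / Q + 3) := by
          push_cast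
          exact mul_le_mul (Nat.floor_le (by positivity)) h2 (by positivity) (by positivity)
      _ = _ := by ring
  have hterm : ∀ μ ∈ I, ‖∑ lam ∈ I, ee (α * lam * μ)‖ ≤
      (if |α * μ - round (α * μ)| < δ then (2 * (H : ℝ) + 1) else 0) + 1 / (2 * δ) := by
    intro μ _
    have hδ' : 0 < 1 / (2 * δ) := by positivity
    split_ifs with h
    · refine (norm_sum_le _ _).trans ?_
      simp only [norm_ee, Finset.sum_const, nsmul_eq_mul, mul_one, hIc]
      linarith
    · push Not at h
      have := geom_le (α * μ) H δ hδ h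
      rw [zero_add]
      have e : ∀ lam : ℤ, α * (lam : ℝ) * μ = α * μ * lam := fun lam => by ring
      simp only [e]
      exact this
  unfold BB
  refine (Finset.sum_le_sum hterm).trans ?_
  rw [Finset.sum_add_distrib, ← Finset.sum_filter, Finset.sum_const, Finset.sum_const, nsmul_eq_mul,
    nsmul_eq_mul, hIc, mul_add]
  have : (0 : ℝ) ≤ 2 * H + 1 := by positivity
  nlinarith

lemma BB_triv (α : ℝ) (H : ℕ) : BB α H ≤ (2 * H + 1) ^ 2 := by
  have hIc : ((Finset.Icc (-(H : ℤ)) H).card : ℝ) = 2 * H + 1 := by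
    rw [Int.card_Icc]
    have : ((H : ℤ) + 1 - -(H : ℤ)).toNat = 2 * H + 1 := by omega
    rw [this]; push_cast; ring
  unfold BB
  have : ∀ μ ∈ Finset.Icc (-(H : ℤ)) H, ‖∑ lam ∈ Finset.Icc (-(H : ℤ)) H, ee (α * lam * μ)‖ ≤ 2 * H + 1 := by
    intro μ _
    refine (norm_sum_le _ _).trans ?_
    simp only [norm_ee, Finset.sum_const, nsmul_eq_mul, mul_one, hIc, le_refl]
  refine (Finset.sum_le_sum this).trans ?_
  rw [Finset.sum_const, nsmul_eq_mul, hIc, sq]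

lemma BB_est2 (α Q w l : ℝ) (H : ℕ) (hl : 1 ≤ l) (hw : 1 ≤ w) (hH : (H : ℝ) = l * w ^ 4) (hα : |α| = 1 / Q)
    (h1 : w ≤ Q) (h2 : Q ≤ w ^ 6) : BB α H ≤ 33 * l ^ 2 * w ^ 7 := by
  have hw0 : 0 < w := by linarith
  have hQ : 0 < Q := by linarith
  have h := BB_est α Q (1 / (2 * w ^ 3)) H hQ hα (by positivity)
  refine h.trans ?_
  rw [hH]
  have e1 : 2 * (1 / (2 * w ^ 3)) * Q = Q / w ^ 3 := by field_simp
  have e2 : 1 / (2 * (1 / (2 * w ^ 3))) = w ^ 3 := by field_simp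
  rw [e1, e2]
  have a1 : 2 * (l * w ^ 4) + 1 ≤ 3 * (l * w ^ 4) := by
    have : 1 ≤ w ^ 4 := one_le_pow₀ hw
    nlinarith
  have a2 : (2 * (l * w ^ 4) / Q + 3) * (Q / w ^ 3 + 1) = 2 * l * w + 2 * l * (w ^ 4 / Q) + 3 * (Q / w ^ 3) + 3 := by
    field_simp
    ring
  have a3 : w ^ 4 / Q ≤ w ^ 3 := by rw [div_le_iff₀ hQ]; nlinarith [pow_pos hw0 3]
  have a4 : Q / w ^ 3 ≤ w ^ 3 := by rw [div_le_iff₀ (by positivity)]; nlinarith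
  have a5 : w ≤ w ^ 3 := le_self_pow₀ hw (by norm_num)
  have a6 : 1 ≤ w ^ 3 := one_le_pow₀ hw
  rw [a2]
  have a7 : 2 * l * w + 2 * l * (w ^ 4 / Q) + 3 * (Q / w ^ 3) + 3 + w ^ 3 ≤ 11 * l * w ^ 3 := by
    have b1 : 2 * l * w ≤ 2 * l * w ^ 3 := by gcongr
    have b2 : 2 * l * (w ^ 4 / Q) ≤ 2 * l * w ^ 3 := by gcongr
    nlinarith
  calc _ ≤ 3 * (l * w ^ 4) * (11 * l * w ^ 3) := by
        refine mul_le_mul a1 a7 (by positivity) (by positivity)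
    _ = _ := by ring

end VK


namespace VK
open Filter

lemma sum_fin_succ (k : ℕ) : ∑ i : Fin k, ((i : ℕ) + 1 : ℝ) = k * (k + 1) / 2 := by
  rw [Fin.sum_univ_eq_sum_range (fun i => ((i : ℕ) + 1 : ℝ))]
  induction k with
  | zero => simp
  | succ k ih => rw [Finset.sum_range_succ, ih]; push_cast; ring

lemma V_bound (k p m : ℕ) (hp : p.Prime) (hk : 2 ≤ k) (hkp : 16 * k ^ 4 ≤ p) (α : Fin k → ℝ)
    (R : Finset (Fin k)) (Lx : ℝ) (hLx : Lx = m * Real.log p)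
    (hR : ∀ i ∈ R, ∃ Q : ℝ, |α i| = 1 / Q ∧ Real.exp (((i : ℕ) + 1) * Lx / 4) ≤ Q ∧
      Q ≤ Real.exp (((i : ℕ) + 1) * Lx / 4) ^ 6) :
    ‖∑ x : Fin (p ^ m), ∑ y : Fin (p ^ m),
      ee (∑ j : Fin k, α j * (x : ℝ) ^ (j.val + 1) * (y : ℝ) ^ (j.val + 1))‖ ^ (4 * (10 * k ^ 2) ^ 2) ≤
    Real.exp (8 * (10 * k ^ 2) ^ 2 * Lx) * Real.exp (48 * k ^ 3 * Real.log p) *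
      (33 * (10 * (k : ℝ) ^ 2) ^ 2) ^ k *
      Real.exp (2 * eta k (8 * k) * Lx - (∑ i ∈ R, ((i : ℕ) + 1 : ℝ)) * Lx / 4) := by
  classical
  have hp0 : (0 : ℝ) < p := by exact_mod_cast hp.pos
  have hp1 : (1 : ℝ) ≤ p := by exact_mod_cast hp.one_lt.le
  have hlp : 0 ≤ Real.log p := Real.log_nonneg hp1
  have hLx0 : 0 ≤ Lx := by rw [hLx]; positivity
  set l := 10 * k ^ 2 with hl
  have hl1 : 1 ≤ l := by rw [hl]; nlinarith
  have hlR : (l : ℝ) = 10 * (k : ℝ) ^ 2 := by rw [hl]; push_cast; ring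
  have hX : ((p ^ m : ℕ) : ℝ) = Real.exp Lx := by
    rw [hLx, ← Real.log_pow, Real.exp_log (by positivity)]; push_cast; rfl
  refine (bilinear l (p ^ m) hl1 α).trans ?_
  have hJ : (JJ k l (p ^ m) : ℝ) ≤ Real.exp (24 * k ^ 3 * Real.log p) *
      Real.exp ((2 * l - k * (k + 1) / 2 + eta k (8 * k)) * Lx) := by
    have := vino k p hp hk hkp (8 * k) m
    have e : 2 * k ^ 2 + 8 * k * k = l := by rw [hl]; ring
    rw [e] at this
    refine this.trans (le_of_eq ?_)
    congr 1
    · rw [show 3 * k ^ 2 * (8 * k) = 24 * k ^ 3 by ring, ← Real.rpow_natCast, Real.rpow_def_of_pos hp0]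
      congr 1; push_cast; ring
    · rw [Real.rpow_def_of_pos hp0]
      congr 1
      rw [hLx, hlR]; push_cast; ring
  have hB : ∏ j : Fin k, BB (α j) (l * (p ^ m) ^ (j.val + 1)) ≤
      (33 * (10 * (k : ℝ) ^ 2) ^ 2) ^ k *
        Real.exp (k * (k + 1) * Lx - (∑ i ∈ R, ((i : ℕ) + 1 : ℝ)) * Lx / 4) := by
    have h1 : ∀ j : Fin k, BB (α j) (l * (p ^ m) ^ (j.val + 1)) ≤ (33 * (10 * (k : ℝ) ^ 2) ^ 2) *
        Real.exp (2 * ((j : ℕ) + 1 : ℝ) * Lx - if j ∈ R then ((j : ℕ) + 1 : ℝ) * Lx / 4 else 0) := by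
      intro j
      set w := Real.exp (((j : ℕ) + 1) * Lx / 4) with hw
      have hw1 : 1 ≤ w := by rw [hw]; exact Real.one_le_exp (by positivity)
      have hH : ((l * (p ^ m) ^ (j.val + 1) : ℕ) : ℝ) = l * w ^ 4 := by
        rw [Nat.cast_mul, Nat.cast_pow, hX, hw, ← Real.exp_nat_mul, ← Real.exp_nat_mul]
        congr 2; push_cast; ring
      have hl1R : (1 : ℝ) ≤ l := by exact_mod_cast hl1
      rw [← hlR]
      split_ifs with hj
      · obtain ⟨Q, q1, q2, q3⟩ := hR j hj
        have := BB_est2 (α j) Q w l _ hl1R hw1 hH q1 q2 q3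
        refine this.trans (le_of_eq ?_)
        rw [hw, ← Real.exp_nat_mul]
        congr 2; push_cast; ring
      · refine (BB_triv _ _).trans ?_
        rw [hH]
        have e : Real.exp (2 * ((j : ℕ) + 1 : ℝ) * Lx - 0) = w ^ 8 := by
          rw [hw, ← Real.exp_nat_mul]
          congr 1; push_cast; ring
        rw [e]
        have : 2 * ((l : ℝ) * w ^ 4) + 1 ≤ 3 * (l * w ^ 4) := by
          have : 1 ≤ w ^ 4 := one_le_pow₀ hw1
          nlinarith
        calc (2 * ((l : ℝ) * w ^ 4) + 1) ^ 2 ≤ (3 * (l * w ^ 4)) ^ 2 := by gcongr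
          _ = 9 * l ^ 2 * w ^ 8 := by ring
          _ ≤ _ := by gcongr; norm_num
    refine (Finset.prod_le_prod (fun j _ => ?_) fun j _ => h1 j).trans (le_of_eq ?_)
    · exact Finset.sum_nonneg fun _ _ => norm_nonneg _
    · rw [Finset.prod_mul_distrib, Finset.prod_const, Finset.card_univ, Fintype.card_fin,
        ← Real.exp_sum, Finset.sum_sub_distrib]
      congr 2
      congr 1
      · rw [← Finset.sum_mul, ← Finset.mul_sum, sum_fin_succ]; ring
      · rw [Finset.sum_ite_mem, Finset.univ_inter, Finset.sum_mul, Finset.sum_div]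
  have hP : ((p ^ m : ℕ) : ℝ) ^ (8 * l ^ 2 - 4 * l) = Real.exp ((8 * l ^ 2 - 4 * l) * Lx) := by
    rw [hX, ← Real.exp_nat_mul, Nat.cast_sub (by nlinarith)]
    push_cast; rfl
  have hB0 : 0 ≤ ∏ j : Fin k, BB (α j) (l * (p ^ m) ^ (j.val + 1)) :=
    Finset.prod_nonneg fun j _ => Finset.sum_nonneg fun _ _ => norm_nonneg _
  rw [hP]
  calc _ ≤ Real.exp ((8 * l ^ 2 - 4 * l) * Lx) * (Real.exp (24 * k ^ 3 * Real.log p) *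
      Real.exp ((2 * l - k * (k + 1) / 2 + eta k (8 * k)) * Lx)) ^ 2 * ((33 * (10 * (k : ℝ) ^ 2) ^ 2) ^ k *
        Real.exp (k * (k + 1) * Lx - (∑ i ∈ R, ((i : ℕ) + 1 : ℝ)) * Lx / 4)) := by gcongr
    _ = (33 * (10 * (k : ℝ) ^ 2) ^ 2) ^ k * (Real.exp ((8 * l ^ 2 - 4 * l) * Lx) *
        (Real.exp (24 * k ^ 3 * Real.log p) *
      Real.exp ((2 * l - k * (k + 1) / 2 + eta k (8 * k)) * Lx)) ^ 2 *
        Real.exp (k * (k + 1) * Lx - (∑ i ∈ R, ((i : ℕ) + 1 : ℝ)) * Lx / 4)) := by ring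
    _ = (33 * (10 * (k : ℝ) ^ 2) ^ 2) ^ k * (Real.exp (8 * (10 * k ^ 2) ^ 2 * Lx) *
        Real.exp (48 * k ^ 3 * Real.log p) *
        Real.exp (2 * eta k (8 * k) * Lx - (∑ i ∈ R, ((i : ℕ) + 1 : ℝ)) * Lx / 4)) := by
        congr 1
        rw [mul_pow, ← Real.exp_nat_mul, ← Real.exp_nat_mul, ← Real.exp_add, ← Real.exp_add, ← Real.exp_add,
          ← Real.exp_add, ← Real.exp_add, ← hlR]
        congr 1; push_cast; ring
    _ = _ := by ring

lemma R_sum (κ : ℝ) (hκ : 1 ≤ κ) (k : ℕ) (hk : 2 * κ ≤ k) :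
    40 / 81 * κ ^ 2 ≤ ∑ i ∈ Finset.univ.filter
      (fun i : Fin k => 10 / 9 * κ ≤ ((i : ℕ) + 1 : ℝ) ∧ ((i : ℕ) + 1 : ℝ) ≤ 2 * κ), ((i : ℕ) + 1 : ℝ) := by
  classical
  set R := Finset.univ.filter
      (fun i : Fin k => 10 / 9 * κ ≤ ((i : ℕ) + 1 : ℝ) ∧ ((i : ℕ) + 1 : ℝ) ≤ 2 * κ) with hR
  have h1 : (R.card : ℝ) * (10 / 9 * κ) ≤ ∑ i ∈ R, ((i : ℕ) + 1 : ℝ) := by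
    rw [← nsmul_eq_mul]
    exact Finset.card_nsmul_le_sum _ _ _ fun i hi => (Finset.mem_filter.1 hi).2.1
  set a := ⌊2 * κ⌋₊ with ha
  set b := ⌈10 / 9 * κ⌉₊ with hb
  have ha1 : (a : ℝ) ≤ 2 * κ := Nat.floor_le (by positivity)
  have ha2 : 2 * κ < a + 1 := Nat.lt_floor_add_one _
  have hb1 : 10 / 9 * κ ≤ b := Nat.le_ceil _
  have hb2 : (b : ℝ) < 10 / 9 * κ + 1 := Nat.ceil_lt_add_one (by positivity)
  have hab : b ≤ a := by
    by_cases c1 : κ ≤ 9 / 5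
    · have : b ≤ 2 := Nat.ceil_le.2 (by push_cast; linarith)
      have : 2 ≤ a := Nat.le_floor (by push_cast; linarith)
      omega
    · have : (b : ℝ) < a + 1 := by linarith
      have : b < a + 1 := by exact_mod_cast this
      omega
  have hb0 : 1 ≤ b := Nat.one_le_ceil_iff.2 (by positivity)
  have h2 : a + 1 - b ≤ R.card := by
    have hak : a ≤ k := by
      have : (a : ℝ) ≤ k := by linarith
      exact_mod_cast this
    have : Finset.Icc b a ⊆ R.image (fun i : Fin k => (i : ℕ) + 1) := by
      intro j hj
      rw [Finset.mem_Icc] at hj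
      rw [Finset.mem_image]
      refine ⟨⟨j - 1, by omega⟩, ?_, by simp; omega⟩
      rw [hR, Finset.mem_filter]
      refine ⟨Finset.mem_univ _, ?_⟩
      have e : (((j - 1 : ℕ) : ℝ) + 1) = j := by
        rw [Nat.cast_sub (by omega)]; push_cast; ring
      have q1 : (b : ℝ) ≤ j := by exact_mod_cast hj.1
      have q2 : (j : ℝ) ≤ a := by exact_mod_cast hj.2
      simp only [e]
      constructor <;> linarith
    have h3 := (Finset.card_le_card this).trans Finset.card_image_le
    rwa [Nat.card_Icc] at h3
  have h3 : 4 / 9 * κ ≤ R.card := by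
    have h4 : ((a : ℝ) + 1 - b) ≤ R.card := by
      have : ((a + 1 - b : ℕ) : ℝ) ≤ R.card := by exact_mod_cast h2
      rw [Nat.cast_sub (by omega)] at this
      push_cast at this; exact this
    by_cases c : κ ≤ 9 / 4
    · have : (b : ℝ) ≤ a := by exact_mod_cast hab
      linarith
    · linarith
  nlinarith

end VK


namespace VK
open Filter

lemma eta_small (k : ℕ) (hk : 2 ≤ k) : eta k (8 * k) ≤ k * (k + 1) / 4000 := by
  have hk0 : (2 : ℝ) ≤ k := by exact_mod_cast hk
  unfold eta
  have h1 : (1 - 1 / (k : ℝ)) ^ (8 * k) ≤ Real.exp (-8) := by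
    have h2 : 1 - 1 / (k : ℝ) ≤ Real.exp (-(1 / k)) := by
      have := Real.add_one_le_exp (-(1 / (k : ℝ))); linarith
    have h3 : 0 ≤ 1 - 1 / (k : ℝ) := by
      have : 1 / (k : ℝ) ≤ 1 := by rw [div_le_one (by linarith)]; linarith
      linarith
    refine (pow_le_pow_left₀ h3 h2 _).trans (le_of_eq ?_)
    rw [← Real.exp_nat_mul]
    congr 1; push_cast; field_simp
  have h4 : Real.exp (-8) ≤ 1 / 2000 := by
    rw [Real.exp_neg, ← one_div]
    apply one_div_le_one_div_of_le (by norm_num)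
    have : Real.exp 8 = Real.exp 1 ^ 8 := by rw [← Real.exp_nat_mul]; norm_num
    rw [this]
    calc (2000 : ℝ) ≤ 2.7 ^ 8 := by norm_num
      _ ≤ _ := pow_le_pow_left₀ (by norm_num) (by linarith [Real.exp_one_gt_d9]) _
  have : (0 : ℝ) ≤ k * (k + 1) / 2 := by positivity
  nlinarith

set_option maxHeartbeats 2000000 in
lemma V_final (κ LN : ℝ) (hκ : 1 ≤ κ) (hLN : 10 ^ 9 * κ ^ 2 ≤ LN) : ∃ k X : ℕ, 5 * κ ≤ k ∧ 1 ≤ X ∧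
    Real.log X ≤ 2 / 5 * LN ∧ ∀ α : Fin k → ℝ, (∀ i : Fin k, ∃ ν : ℝ, LN ≤ ν ∧ ν ≤ LN + 1 ∧
      |α i| = 1 / (2 * Real.pi * ((i : ℕ) + 1) * Real.exp (((i : ℕ) + 1) * ν - κ * LN))) →
    ‖∑ x : Fin X, ∑ y : Fin X,
      ee (∑ j : Fin k, α j * (x : ℝ) ^ (j.val + 1) * (y : ℝ) ^ (j.val + 1))‖ ≤
      (X : ℝ) ^ 2 * Real.exp (-(LN / (10 ^ 8 * κ ^ 2))) := by
  classical
  set k := ⌈5 * κ⌉₊ with hkd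
  have hk1 : 5 * κ ≤ k := Nat.le_ceil _
  have hk2 : (k : ℝ) ≤ 6 * κ := by
    have := Nat.ceil_lt_add_one (show 0 ≤ 5 * κ by positivity)
    linarith
  have hk5 : (5 : ℝ) ≤ k := by linarith
  have hk5' : 5 ≤ k := by exact_mod_cast hk5
  obtain ⟨p, hp, hp1, hp2⟩ := Nat.exists_prime_lt_and_le_two_mul (16 * k ^ 4) (by positivity)
  have hp0 : (0 : ℝ) < p := by exact_mod_cast hp.pos
  have hlogp0 : 0 < Real.log p := Real.log_pos (by exact_mod_cast hp.one_lt)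
  have hlogk : Real.log k ≤ k := (Real.log_le_sub_one_of_pos (by linarith)).trans (by linarith)
  have hlogp : Real.log p ≤ 55 * κ := by
    have h1 : (p : ℝ) ≤ 32 * (k : ℝ) ^ 4 := by
      have : p ≤ 32 * k ^ 4 := by omega
      exact_mod_cast this
    have h2 := Real.log_le_log hp0 h1
    rw [Real.log_mul (by norm_num) (by positivity), Real.log_pow] at h2
    have h3 := Real.log_le_sub_one_of_pos (show (0 : ℝ) < 32 by norm_num)
    push_cast at h2
    linarith
  have hκ2 : κ ≤ κ ^ 2 := by nlinarith
  have hLN0 : 10 ^ 9 * κ ≤ LN := by linarith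
  set m := ⌊2 / 5 * LN / Real.log p⌋₊ with hm
  set Lx := m * Real.log p with hLx
  have hm0 : 0 ≤ 2 / 5 * LN / Real.log p := by
    have : 0 ≤ LN := by linarith
    positivity
  have hLx1 : Lx ≤ 2 / 5 * LN := by
    have := Nat.floor_le hm0
    rwa [le_div_iff₀ hlogp0] at this
  have hLx2 : 2 / 5 * LN - Real.log p ≤ Lx := by
    have := Nat.lt_floor_add_one (2 / 5 * LN / Real.log p)
    rw [div_lt_iff₀ hlogp0] at this
    rw [hLx]
    nlinarith
  have hLx3 : 39 / 100 * LN ≤ Lx := by linarith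
  have hX : Real.log ((p ^ m : ℕ) : ℝ) = Lx := by rw [Nat.cast_pow, Real.log_pow]
  refine ⟨k, p ^ m, hk1, Nat.one_le_pow _ _ hp.pos, by rw [hX]; exact hLx1, ?_⟩
  intro α hα
  set R := Finset.univ.filter
      (fun i : Fin k => 10 / 9 * κ ≤ ((i : ℕ) + 1 : ℝ) ∧ ((i : ℕ) + 1 : ℝ) ≤ 2 * κ) with hR
  have hRs := R_sum κ hκ k (by linarith)
  rw [← hR] at hRs
  have hV := V_bound k p m hp (by omega) hp1.le α R Lx hLx (by
    intro i hi
    rw [hR, Finset.mem_filter] at hi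
    obtain ⟨-, h1, h2⟩ := hi
    obtain ⟨ν, n1, n2, n3⟩ := hα i
    set j : ℝ := ((i : ℕ) + 1 : ℝ) with hj
    have hj1 : 1 ≤ j := by rw [hj]; linarith [show (0 : ℝ) ≤ (i : ℕ) by positivity]
    refine ⟨_, n3, ?_, ?_⟩
    · have : 1 ≤ 2 * Real.pi * j := by nlinarith [Real.pi_gt_three]
      refine le_trans ?_ (le_mul_of_one_le_left (Real.exp_pos _).le this)
      rw [Real.exp_le_exp]
      have a1 : j * Lx ≤ j * (2 / 5 * LN) := by gcongr
      have a2 : j * LN ≤ j * ν := by gcongr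
      have a3 : κ * LN ≤ 9 / 10 * j * LN := by
        have : 0 ≤ LN := by linarith
        nlinarith
      linarith
    · have : 2 * Real.pi * j ≤ Real.exp (7 * j) := by
        have := Real.add_one_le_exp (7 * j)
        nlinarith [Real.pi_lt_d2]
      rw [← Real.exp_nat_mul]
      refine (mul_le_mul_of_nonneg_right this (Real.exp_pos _).le).trans ?_
      rw [← Real.exp_add, Real.exp_le_exp]
      push_cast
      have a1 : j * (39 / 100 * LN) ≤ j * Lx := by gcongr
      have a2 : j * ν ≤ j * (LN + 1) := by gcongr
      have a3 : j / 2 * LN ≤ κ * LN := by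
        have : 0 ≤ LN := by linarith
        nlinarith
      have a4 : j * 1000 ≤ j * LN := by gcongr; linarith
      linarith)
  set V := ∑ x : Fin (p ^ m), ∑ y : Fin (p ^ m),
      ee (∑ j : Fin k, α j * (x : ℝ) ^ (j.val + 1) * (y : ℝ) ^ (j.val + 1)) with hVd
  -- numeric estimates
  have hη := eta_small k (by omega)
  have hη2 : 2 * eta k (8 * k) ≤ 21 / 1000 * κ ^ 2 := by nlinarith
  have hE1 : 48 * (k : ℝ) ^ 3 * Real.log p ≤ 570240 * κ ^ 4 := by
    have : (k : ℝ) ^ 3 ≤ (6 * κ) ^ 3 := by gcongr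
    calc 48 * (k : ℝ) ^ 3 * Real.log p ≤ 48 * (6 * κ) ^ 3 * (55 * κ) := by gcongr
      _ = _ := by ring
  have hE2 : (33 * (10 * (k : ℝ) ^ 2) ^ 2) ^ k ≤ Real.exp (19944 * κ ^ 2) := by
    have h1 : 33 * (10 * (k : ℝ) ^ 2) ^ 2 = Real.exp (Real.log 3300 + 4 * Real.log k) := by
      have : Real.log 3300 + 4 * Real.log k = Real.log (3300 * (k : ℝ) ^ 4) := by
        rw [Real.log_mul (by norm_num) (by positivity), Real.log_pow]; push_cast; rfl
      rw [this, Real.exp_log (by positivity)]; ring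
    rw [h1, ← Real.exp_nat_mul, Real.exp_le_exp]
    have h2 := Real.log_le_sub_one_of_pos (show (0 : ℝ) < 3300 by norm_num)
    calc (k : ℝ) * (Real.log 3300 + 4 * Real.log k) ≤ (6 * κ) * (3300 * κ + 4 * (6 * κ)) := by
          have : 0 ≤ Real.log 3300 := Real.log_nonneg (by norm_num)
          have : 0 ≤ Real.log k := Real.log_nonneg (by linarith)
          gcongr <;> linarith
      _ = _ := by ring
  set l : ℝ := 10 * (k : ℝ) ^ 2 with hl
  have hLN' : 0 ≤ LN := by linarith
  have hκ4 : κ ^ 2 ≤ κ ^ 4 := by nlinarith [sq_nonneg κ]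
  have hE3 : 48 * (k : ℝ) ^ 3 * Real.log p + 19944 * κ ^ 2 +
      (2 * eta k (8 * k) * Lx - (∑ i ∈ R, ((i : ℕ) + 1 : ℝ)) * Lx / 4) ≤ -(39 / 1000 * (κ ^ 2 * LN)) := by
    have hLx0 : 0 ≤ Lx := by linarith
    have b1 : 2 * eta k (8 * k) * Lx ≤ 21 / 1000 * κ ^ 2 * Lx := by gcongr
    have b2 : 40 / 81 * κ ^ 2 * Lx ≤ (∑ i ∈ R, ((i : ℕ) + 1 : ℝ)) * Lx := by gcongr
    have b3 : κ ^ 2 * (39 / 100 * LN) ≤ κ ^ 2 * Lx := by gcongr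
    have b4 : κ ^ 2 * (10 ^ 9 * κ ^ 2) ≤ κ ^ 2 * LN := by gcongr
    linarith
  have hfin : ‖V‖ ^ (4 * (10 * k ^ 2) ^ 2) ≤
      Real.exp (2 * Lx - LN / (10 ^ 8 * κ ^ 2)) ^ (4 * (10 * k ^ 2) ^ 2) := by
    refine hV.trans ?_
    rw [← Real.exp_nat_mul]
    have e : ((4 * (10 * k ^ 2) ^ 2 : ℕ) : ℝ) = 4 * l ^ 2 := by rw [hl]; push_cast; ring
    rw [e]
    calc _ ≤ Real.exp (8 * l ^ 2 * Lx) * Real.exp (48 * k ^ 3 * Real.log p) * Real.exp (19944 * κ ^ 2) *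
        Real.exp (2 * eta k (8 * k) * Lx - (∑ i ∈ R, ((i : ℕ) + 1 : ℝ)) * Lx / 4) := by gcongr
      _ = Real.exp (8 * l ^ 2 * Lx + (48 * (k : ℝ) ^ 3 * Real.log p + 19944 * κ ^ 2 +
        (2 * eta k (8 * k) * Lx - (∑ i ∈ R, ((i : ℕ) + 1 : ℝ)) * Lx / 4))) := by
        rw [← Real.exp_add, ← Real.exp_add, ← Real.exp_add]; congr 1; ring
      _ ≤ _ := by
        rw [Real.exp_le_exp]
        have c1 : l ≤ 360 * κ ^ 2 := by
          rw [hl]; nlinarith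
        have c2 : l ^ 2 ≤ (360 * κ ^ 2) ^ 2 := by
          have : 0 ≤ l := by positivity
          gcongr
        have c3 : 4 * l ^ 2 * (LN / (10 ^ 8 * κ ^ 2)) ≤ 39 / 1000 * (κ ^ 2 * LN) := by
          calc 4 * l ^ 2 * (LN / (10 ^ 8 * κ ^ 2)) ≤ 4 * (360 * κ ^ 2) ^ 2 * (LN / (10 ^ 8 * κ ^ 2)) := by
                gcongr
            _ = 518400 / 10 ^ 8 * (κ ^ 2 * LN) := by field_simp; ring
            _ ≤ _ := mul_le_mul_of_nonneg_right (by norm_num) (by positivity)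
        linarith
  have h9 : ‖V‖ ≤ Real.exp (2 * Lx - LN / (10 ^ 8 * κ ^ 2)) :=
    le_of_pow_le_pow_left₀ (by positivity) (Real.exp_pos _).le hfin
  refine h9.trans (le_of_eq ?_)
  have hXpos : (0 : ℝ) < ((p ^ m : ℕ) : ℝ) := by exact_mod_cast Nat.pow_pos hp.pos
  rw [sub_eq_add_neg, Real.exp_add, two_mul, Real.exp_add, ← hX, Real.exp_log hXpos, sq ((p ^ m : ℕ) : ℝ)]

end VK


namespace VK
open Filter

lemma tele (g : ℕ → ℂ) (a b : ℕ) (h : a ≤ b) : ∑ n ∈ Finset.Ico a b, (g (n + 1) - g n) = g b - g a := by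
  induction b, h using Nat.le_induction with
  | base => simp
  | succ b hb ih => rw [Finset.sum_Ico_succ_top hb, ih]; ring

lemma shift (f : ℕ → ℂ) (hf : ∀ n, ‖f n‖ ≤ 1) (a b : ℕ) (hab : a ≤ b) (h : ℕ) :
    ‖∑ n ∈ Finset.Ico a b, f (n + h) - ∑ n ∈ Finset.Ico a b, f n‖ ≤ 2 * h := by
  induction h with
  | zero => simp
  | succ h ih =>
    have e : ∑ n ∈ Finset.Ico a b, f (n + (h + 1)) - ∑ n ∈ Finset.Ico a b, f n =
        (f (b + h) - f (a + h)) + (∑ n ∈ Finset.Ico a b, f (n + h) - ∑ n ∈ Finset.Ico a b, f n) := by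
      have := tele (fun n => f (n + h)) a b hab
      rw [Finset.sum_sub_distrib] at this
      rw [← this]
      have : ∀ n : ℕ, n + 1 + h = n + (h + 1) := fun n => by ring
      simp only [this]; ring
    rw [e]
    refine (norm_add_le _ _).trans ?_
    have h1 := norm_sub_le (f (b + h)) (f (a + h))
    have := hf (b + h); have := hf (a + h)
    push_cast; linarith

lemma ee_lip (a b : ℝ) : ‖ee a - ee b‖ ≤ 2 * Real.pi * |a - b| := by
  have e : ee a - ee b = ee b * (ee (a - b) - 1) := by
    rw [mul_sub, ← ee_add]; simp
  rw [e, norm_mul, norm_ee, one_mul]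
  unfold ee
  have h3 := Real.norm_exp_I_mul_ofReal_sub_one_le (x := 2 * Real.pi * (a - b))
  rw [mul_comm Complex.I] at h3
  refine h3.trans (le_of_eq ?_)
  rw [Real.norm_eq_abs, abs_mul, abs_of_pos (by positivity)]

lemma local_sum (κ LN t : ℝ) (N k X n : ℕ) (hN : 1 ≤ N) (hκ : 1 ≤ κ) (hLN : 10 ^ 9 * κ ^ 2 ≤ LN)
    (hLNN : LN = Real.log N) (ht : t = Real.exp (κ * LN)) (hk : 5 * κ ≤ k) (hX1 : 1 ≤ X)
    (hX : Real.log X ≤ 2 / 5 * LN)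
    (hV : ∀ α : Fin k → ℝ, (∀ i : Fin k, ∃ ν : ℝ, LN ≤ ν ∧ ν ≤ LN + 1 ∧
      |α i| = 1 / (2 * Real.pi * ((i : ℕ) + 1) * Real.exp (((i : ℕ) + 1) * ν - κ * LN))) →
    ‖∑ x : Fin X, ∑ y : Fin X, ee (∑ j : Fin k, α j * (x : ℝ) ^ (j.val + 1) * (y : ℝ) ^ (j.val + 1))‖ ≤
      (X : ℝ) ^ 2 * Real.exp (-(LN / (10 ^ 8 * κ ^ 2)))) (hn1 : N ≤ n) (hn2 : n ≤ 2 * N) :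
    ‖∑ x : Fin X, ∑ y : Fin X, ee (t / (2 * Real.pi) * Real.log ((n + x.val * y.val : ℕ) : ℝ))‖ ≤
      (X : ℝ) ^ 2 * (Real.exp (-(LN / (10 ^ 8 * κ ^ 2))) + 2 * Real.exp (-(LN / 5))) := by
  have hN0 : (1 : ℝ) ≤ N := by exact_mod_cast hN
  have hnN : (N : ℝ) ≤ n := by exact_mod_cast hn1
  have hn0 : (0 : ℝ) < n := by linarith
  have hLN9 : 10 ^ 9 ≤ LN := by nlinarith
  have htp : 0 < t := by rw [ht]; positivity
  have hpi := Real.pi_pos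
  have hexpN : Real.exp LN = N := by rw [hLNN]; exact Real.exp_log (by linarith)
  have hX0 : (1 : ℝ) ≤ X := by exact_mod_cast hX1
  have hXe : (X : ℝ) ≤ Real.exp (2 / 5 * LN) := by
    rw [← Real.log_le_iff_le_exp (by linarith)]; exact hX
  set α : Fin k → ℝ := fun j => (-1) ^ (j : ℕ) * (t / (2 * Real.pi)) / (((j : ℕ) + 1) * (n : ℝ) ^ ((j : ℕ) + 1)) with hα
  have hVα := hV α (by
    intro i
    refine ⟨Real.log n, ?_, ?_, ?_⟩
    · rw [hLNN]; exact Real.log_le_log (by linarith) hnN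
    · have h2 : (n : ℝ) ≤ 2 * N := by exact_mod_cast hn2
      have := Real.log_le_log hn0 h2
      rw [Real.log_mul (by norm_num) (by linarith)] at this
      have := Real.log_two_lt_d9
      rw [hLNN]; linarith
    · rw [hα]
      simp only
      rw [abs_div, abs_mul, abs_pow, abs_neg, abs_one, one_pow, one_mul, abs_of_pos (by positivity),
        abs_of_pos (by positivity), Real.exp_sub, ← ht,
        show (((i : ℕ) : ℝ) + 1) * Real.log n = ((i : ℕ) + 1 : ℕ) * Real.log n by push_cast; ring, Real.exp_nat_mul,
        Real.exp_log hn0]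
      field_simp)
  have key : ∀ x y : Fin X, ‖ee (t / (2 * Real.pi) * Real.log ((n + x.val * y.val : ℕ) : ℝ)) -
      ee (t / (2 * Real.pi) * Real.log n) *
        ee (∑ j : Fin k, α j * (x : ℝ) ^ (j.val + 1) * (y : ℝ) ^ (j.val + 1))‖ ≤ 2 * Real.exp (-(LN / 5)) := by
    intro x y
    rw [← ee_add]
    refine (ee_lip _ _).trans ?_
    set z : ℝ := (x : ℝ) * (y : ℝ) / n with hz
    have hz0 : 0 ≤ z := by rw [hz]; positivity
    have hx : (x : ℝ) ≤ Real.exp (2 / 5 * LN) := le_trans (by exact_mod_cast x.2.le) hXe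
    have hy : (y : ℝ) ≤ Real.exp (2 / 5 * LN) := le_trans (by exact_mod_cast y.2.le) hXe
    have hz1 : z ≤ Real.exp (-(LN / 5)) := by
      rw [hz, div_le_iff₀ hn0]
      calc (x : ℝ) * (y : ℝ) ≤ Real.exp (2 / 5 * LN) * Real.exp (2 / 5 * LN) := by gcongr
        _ = Real.exp (-(LN / 5)) * Real.exp LN := by rw [← Real.exp_add, ← Real.exp_add]; congr 1; ring
        _ ≤ _ := by rw [hexpN]; gcongr
    have hz2 : Real.exp (-(LN / 5)) ≤ 1 / 2 := by
      rw [Real.exp_neg, ← one_div]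
      apply one_div_le_one_div_of_le (by norm_num)
      have := Real.add_one_le_exp (LN / 5); linarith
    have hlog : Real.log ((n + x.val * y.val : ℕ) : ℝ) = Real.log n + Real.log (1 - -z) := by
      rw [← Real.log_mul (by linarith) (by linarith)]
      congr 1; rw [hz]; push_cast; field_simp; ring
    have hsum : ∑ j : Fin k, α j * (x : ℝ) ^ (j.val + 1) * (y : ℝ) ^ (j.val + 1) =
        -(t / (2 * Real.pi) * ∑ i ∈ Finset.range k, (-z) ^ (i + 1) / ((i : ℝ) + 1)) := by
      rw [← Fin.sum_univ_eq_sum_range (fun i => (-z) ^ (i + 1) / ((i : ℝ) + 1)) k, Finset.mul_sum, ← Finset.sum_neg_distrib]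
      refine Finset.sum_congr rfl fun j _ => ?_
      rw [hα, hz]
      simp only
      rw [neg_pow ((x : ℝ) * (y : ℝ) / n), div_pow, mul_pow, pow_succ (-1 : ℝ)]
      field_simp
    have e : t / (2 * Real.pi) * Real.log ((n + x.val * y.val : ℕ) : ℝ) - (t / (2 * Real.pi) * Real.log n +
        ∑ j : Fin k, α j * (x : ℝ) ^ (j.val + 1) * (y : ℝ) ^ (j.val + 1)) =
        t / (2 * Real.pi) * ((∑ i ∈ Finset.range k, (-z) ^ (i + 1) / ((i : ℝ) + 1)) + Real.log (1 - -z)) := by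
      rw [hlog, hsum]; ring
    rw [e, abs_mul, abs_of_pos (by positivity)]
    have hT := Real.abs_log_sub_add_sum_range_le (x := -z) (by rw [abs_neg, abs_of_nonneg hz0]; linarith) k
    rw [abs_neg, abs_of_nonneg hz0] at hT
    have hT2 : z ^ (k + 1) / (1 - z) ≤ 2 * z ^ (k + 1) := by
      rw [div_le_iff₀ (by linarith)]
      have : 0 ≤ z ^ (k + 1) := by positivity
      nlinarith
    have hT3 : z ^ (k + 1) ≤ Real.exp (-((k + 1) * (LN / 5))) := by
      refine (pow_le_pow_left₀ hz0 hz1 _).trans (le_of_eq ?_)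
      rw [← Real.exp_nat_mul]; congr 1; push_cast; ring
    calc 2 * Real.pi * (t / (2 * Real.pi) * |(∑ i ∈ Finset.range k, (-z) ^ (i + 1) / ((i : ℝ) + 1)) + Real.log (1 - -z)|)
        = t * |(∑ i ∈ Finset.range k, (-z) ^ (i + 1) / ((i : ℝ) + 1)) + Real.log (1 - -z)| := by field_simp
      _ ≤ t * (2 * Real.exp (-((k + 1) * (LN / 5)))) := by
          apply mul_le_mul_of_nonneg_left _ htp.le
          linarith
      _ = 2 * Real.exp (κ * LN + -((k + 1) * (LN / 5))) := by rw [Real.exp_add, ht]; ring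
      _ ≤ _ := by
          gcongr
          nlinarith
  have hsplit : ‖(∑ x : Fin X, ∑ y : Fin X, ee (t / (2 * Real.pi) * Real.log ((n + x.val * y.val : ℕ) : ℝ))) -
      ee (t / (2 * Real.pi) * Real.log n) *
      ∑ x : Fin X, ∑ y : Fin X, ee (∑ j : Fin k, α j * (x : ℝ) ^ (j.val + 1) * (y : ℝ) ^ (j.val + 1))‖ ≤
      (X : ℝ) ^ 2 * (2 * Real.exp (-(LN / 5))) := by
    rw [Finset.mul_sum, ← Finset.sum_sub_distrib]
    simp_rw [Finset.mul_sum, ← Finset.sum_sub_distrib]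
    refine (norm_sum_le_of_le _ fun x _ => norm_sum_le_of_le _ fun y _ => key x y).trans (le_of_eq ?_)
    simp; ring
  have h5 := norm_add_le ((∑ x : Fin X, ∑ y : Fin X, ee (t / (2 * Real.pi) * Real.log ((n + x.val * y.val : ℕ) : ℝ))) -
      ee (t / (2 * Real.pi) * Real.log n) *
      ∑ x : Fin X, ∑ y : Fin X, ee (∑ j : Fin k, α j * (x : ℝ) ^ (j.val + 1) * (y : ℝ) ^ (j.val + 1)))
      (ee (t / (2 * Real.pi) * Real.log n) *
      ∑ x : Fin X, ∑ y : Fin X, ee (∑ j : Fin k, α j * (x : ℝ) ^ (j.val + 1) * (y : ℝ) ^ (j.val + 1)))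
  rw [sub_add_cancel, norm_mul, norm_ee, one_mul] at h5
  linarith

lemma vk_main (κ LN t : ℝ) (N N' : ℕ) (hN : 1 ≤ N) (hκ : 1 ≤ κ) (hLN : 10 ^ 9 * κ ^ 2 ≤ LN)
    (hLNN : LN = Real.log N) (ht : t = Real.exp (κ * LN)) (h1 : N ≤ N') (h2 : N' ≤ 2 * N) :
    ‖∑ n ∈ Finset.Ico N N', ee (t / (2 * Real.pi) * Real.log n)‖ ≤
      5 * N * Real.exp (-(LN / (10 ^ 8 * κ ^ 2))) := by
  obtain ⟨k, X, hk, hX1, hX, hV⟩ := V_final κ LN hκ hLN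
  have hX0 : (1 : ℝ) ≤ X := by exact_mod_cast hX1
  have hN0 : (1 : ℝ) ≤ N := by exact_mod_cast hN
  have hexpN : Real.exp LN = N := by rw [hLNN]; exact Real.exp_log (by linarith)
  have hXe : (X : ℝ) ≤ Real.exp (2 / 5 * LN) := by
    rw [← Real.log_le_iff_le_exp (by linarith)]; exact hX
  have hLN9 : 10 ^ 9 ≤ LN := by nlinarith
  set f : ℕ → ℂ := fun n => ee (t / (2 * Real.pi) * Real.log n) with hf
  set S := ∑ n ∈ Finset.Ico N N', f n with hS
  set E := Real.exp (-(LN / (10 ^ 8 * κ ^ 2))) with hE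
  have hE2 : Real.exp (-(LN / 5)) ≤ E := by
    rw [hE]; gcongr
    nlinarith
  have hU : ‖∑ x : Fin X, ∑ y : Fin X, ∑ n ∈ Finset.Ico N N', f (n + x.val * y.val)‖ ≤
      N * ((X : ℝ) ^ 2 * (E + 2 * Real.exp (-(LN / 5)))) := by
    have e : ∑ x : Fin X, ∑ y : Fin X, ∑ n ∈ Finset.Ico N N', f (n + x.val * y.val) =
        ∑ n ∈ Finset.Ico N N', ∑ x : Fin X, ∑ y : Fin X, f (n + x.val * y.val) := by
      rw [Finset.sum_comm (s := Finset.Ico N N')]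
      refine Finset.sum_congr rfl fun x _ => ?_
      rw [Finset.sum_comm]
    rw [e]
    refine (norm_sum_le_of_le (n := fun _ => (X : ℝ) ^ 2 * (E + 2 * Real.exp (-(LN / 5)))) _ (fun n hn => ?_)).trans ?_
    · rw [Finset.mem_Ico] at hn
      exact local_sum κ LN t N k X n hN hκ hLN hLNN ht hk hX1 hX hV hn.1 (by omega)
    · rw [Finset.sum_const, Nat.card_Ico, nsmul_eq_mul]
      gcongr
      omega
  have hD : ‖(∑ x : Fin X, ∑ y : Fin X, ∑ n ∈ Finset.Ico N N', f (n + x.val * y.val)) - (X : ℂ) ^ 2 * S‖ ≤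
      (X : ℝ) ^ 2 * (2 * (X : ℝ) ^ 2) := by
    have e : (X : ℂ) ^ 2 * S = ∑ x : Fin X, ∑ y : Fin X, S := by simp; ring
    rw [e, ← Finset.sum_sub_distrib]
    simp_rw [← Finset.sum_sub_distrib (s := (Finset.univ : Finset (Fin X)))]
    have hb : ∀ x y : Fin X, ‖(∑ n ∈ Finset.Ico N N', f (n + x.val * y.val)) - S‖ ≤ 2 * (X : ℝ) ^ 2 := by
      intro x y
      refine (shift f (fun n => (norm_ee _).le) N N' h1 (x.val * y.val)).trans ?_
      have : (x.val * y.val : ℕ) ≤ X ^ 2 := by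
        rw [sq]; exact Nat.mul_le_mul x.2.le y.2.le
      have : ((x.val * y.val : ℕ) : ℝ) ≤ (X : ℝ) ^ 2 := by exact_mod_cast this
      linarith
    refine (norm_sum_le_of_le _ fun x _ => norm_sum_le_of_le _ fun y _ => hb x y).trans (le_of_eq ?_)
    simp; ring
  have h5 := norm_sub_norm_le ((X : ℂ) ^ 2 * S) (∑ x : Fin X, ∑ y : Fin X, ∑ n ∈ Finset.Ico N N', f (n + x.val * y.val))
  rw [norm_sub_rev, norm_mul, norm_pow, Complex.norm_natCast] at h5
  have h6 : (X : ℝ) ^ 2 * ‖S‖ ≤ (X : ℝ) ^ 2 * (N * (E + 2 * Real.exp (-(LN / 5))) + 2 * (X : ℝ) ^ 2) := by nlinarith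
  have h7 := le_of_mul_le_mul_left h6 (by positivity)
  have h8 : (X : ℝ) ^ 2 ≤ N * E := by
    calc (X : ℝ) ^ 2 ≤ Real.exp (2 / 5 * LN) ^ 2 := by gcongr
      _ = Real.exp LN * Real.exp (-(LN / 5)) := by rw [← Real.exp_nat_mul, ← Real.exp_add]; congr 1; push_cast; ring
      _ ≤ _ := by rw [hexpN]; gcongr
  have h9 : (N : ℝ) * (E + 2 * Real.exp (-(LN / 5))) ≤ N * (E + 2 * E) := by gcongr
  linarith

lemma vk_all (t : ℝ) (N N' : ℕ) (hN : 2 ≤ N) (ht : (N : ℝ) ≤ t) (h1 : N ≤ N') (h2 : N' ≤ 2 * N) :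
    ‖∑ n ∈ Finset.Ico N N', ee (t / (2 * Real.pi) * Real.log n)‖ ≤
      Real.exp 10 * N * Real.exp (-(Real.log N ^ 3 / (10 ^ 8 * Real.log t ^ 2))) := by
  have hN0 : (2 : ℝ) ≤ N := by exact_mod_cast hN
  have hl : 0 < Real.log N := Real.log_pos (by linarith)
  have hlt : Real.log N ≤ Real.log t := Real.log_le_log (by linarith) ht
  set LN := Real.log N with hLN
  set κ := Real.log t / LN with hκ
  have hκ1 : 1 ≤ κ := by rw [hκ, le_div_iff₀ hl]; linarith
  have hlt0 : 0 < Real.log t := by linarith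
  have e : LN ^ 3 / (10 ^ 8 * Real.log t ^ 2) = LN / (10 ^ 8 * κ ^ 2) := by
    rw [hκ]; field_simp
  rw [e]
  by_cases hc : 10 ^ 9 * κ ^ 2 ≤ LN
  · refine (vk_main κ LN t N N' (by omega) hκ1 hc hLN ?_ h1 h2).trans ?_
    · rw [hκ, div_mul_cancel₀ _ hl.ne', Real.exp_log (by linarith)]
    · gcongr
      have := Real.add_one_le_exp 10; linarith
  · push Not at hc
    have hb : ‖∑ n ∈ Finset.Ico N N', ee (t / (2 * Real.pi) * Real.log n)‖ ≤ N := by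
      refine (norm_sum_le_of_le _ fun n _ => (norm_ee _).le).trans ?_
      rw [Finset.sum_const, Nat.card_Ico, nsmul_eq_mul, mul_one]
      exact_mod_cast (by omega : N' - N ≤ N)
    refine hb.trans ?_
    have : 1 ≤ Real.exp 10 * Real.exp (-(LN / (10 ^ 8 * κ ^ 2))) := by
      rw [← Real.exp_add]; apply Real.one_le_exp
      have : LN / (10 ^ 8 * κ ^ 2) ≤ 10 := by
        rw [div_le_iff₀ (by positivity)]; linarith
      linarith
    nlinarith
end VK


namespace VK
open Filter

lemma abel (f : ℕ → ℂ) (a : ℕ → ℝ) (N N' : ℕ) (h : N ≤ N') (B : ℝ) (hN : 1 ≤ N)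
    (ha : ∀ n, N ≤ n → a (n + 1) ≤ a n) (ha0 : ∀ n, 0 ≤ a n)
    (hB : ∀ n, N ≤ n → n ≤ N' → ‖∑ m ∈ Finset.Ico N n, f m‖ ≤ B) :
    ‖∑ n ∈ Finset.Ico N N', (a n : ℂ) * f n‖ ≤ a N * B := by
  have e : ∀ n, N ≤ n → ∑ m ∈ Finset.Ico N n, (a m : ℂ) * f m = a n * (∑ m ∈ Finset.Ico N n, f m) +
      ∑ m ∈ Finset.Ico N n, ((a m - a (m + 1) : ℝ) : ℂ) * ∑ l ∈ Finset.Ico N (m + 1), f l := by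
    intro n hn
    induction n, hn using Nat.le_induction with
    | base => simp
    | succ n hn ih =>
      rw [Finset.sum_Ico_succ_top hn, ih, Finset.sum_Ico_succ_top hn, Finset.sum_Ico_succ_top hn,
        Finset.sum_Ico_succ_top hn]
      push_cast; ring
  have t : ∀ n, N ≤ n → ∑ m ∈ Finset.Ico N n, (a m - a (m + 1)) * B = (a N - a n) * B := by
    intro n hn
    induction n, hn using Nat.le_induction with
    | base => simp
    | succ n hn ih => rw [Finset.sum_Ico_succ_top hn, ih]; ring
  rw [e N' h]
  refine (norm_add_le _ _).trans ?_
  have h1 : ‖(a N' : ℂ) * (∑ m ∈ Finset.Ico N N', f m)‖ ≤ a N' * B := by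
    rw [norm_mul, Complex.norm_real, Real.norm_eq_abs, abs_of_nonneg (ha0 _)]
    exact mul_le_mul_of_nonneg_left (hB N' h le_rfl) (ha0 _)
  have h2 : ‖∑ m ∈ Finset.Ico N N', ((a m - a (m + 1) : ℝ) : ℂ) * ∑ l ∈ Finset.Ico N (m + 1), f l‖ ≤
      ∑ m ∈ Finset.Ico N N', (a m - a (m + 1)) * B := by
    refine norm_sum_le_of_le _ fun m hm => ?_
    rw [Finset.mem_Ico] at hm
    have := ha m hm.1
    rw [norm_mul, Complex.norm_real, Real.norm_eq_abs, abs_of_nonneg (by linarith)]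
    exact mul_le_mul_of_nonneg_left (hB (m + 1) (by omega) (by omega)) (by linarith)
  rw [t N' h] at h2
  linarith

lemma block (t : ℝ) (i N' : ℕ) (hi : 1 ≤ i) (ht : (2 : ℝ) ^ i ≤ t) (h1 : 2 ^ i ≤ N') (h2 : N' ≤ 2 ^ (i + 1)) :
    ‖∑ n ∈ Finset.Ico (2 ^ i) N', (((n : ℝ)⁻¹ : ℝ) : ℂ) * ee (t / (2 * Real.pi) * Real.log n)‖ ≤
      Real.exp 10 * Real.exp (-(((i : ℝ) * Real.log 2) ^ 3 / (10 ^ 8 * Real.log t ^ 2))) := by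
  have h2i : 2 ≤ 2 ^ i := by
    calc 2 = 2 ^ 1 := by norm_num
      _ ≤ 2 ^ i := Nat.pow_le_pow_right (by norm_num) hi
  have := abel (fun n => ee (t / (2 * Real.pi) * Real.log n)) (fun n => (n : ℝ)⁻¹) (2 ^ i) N' h1
    (Real.exp 10 * (2 ^ i : ℕ) * Real.exp (-(Real.log (2 ^ i : ℕ) ^ 3 / (10 ^ 8 * Real.log t ^ 2)))) (by omega)
    (fun n hn => by
      have : (1 : ℝ) ≤ n := by exact_mod_cast (by omega : 1 ≤ n)
      push_cast
      exact inv_anti₀ (by linarith) (by linarith)) (fun n => by positivity)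
    (fun n hn hn' => vk_all t (2 ^ i) n h2i (by push_cast; exact ht) hn (by rw [pow_succ] at h2; omega))
  refine this.trans (le_of_eq ?_)
  push_cast
  rw [Real.log_pow]
  field_simp

lemma head (t : ℝ) (K : ℕ) (hK : K = 0 ∨ (2 : ℝ) ^ K ≤ t) (M : ℕ) (hM1 : 1 ≤ M) (hM : M ≤ 2 ^ (K + 1)) :
    ‖∑ n ∈ Finset.Ico 1 M, (((n : ℝ)⁻¹ : ℝ) : ℂ) * ee (t / (2 * Real.pi) * Real.log n)‖ ≤
      1 + ∑ i ∈ Finset.range K,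
        Real.exp 10 * Real.exp (-((((i + 1 : ℕ) : ℝ) * Real.log 2) ^ 3 / (10 ^ 8 * Real.log t ^ 2))) := by
  induction K generalizing M with
  | zero =>
    have : M = 1 ∨ M = 2 := by norm_num at hM; omega
    rcases this with rfl | rfl
    · simp
    · rw [show Finset.Ico 1 2 = {1} from rfl]
      simp [norm_ee]
  | succ K ih =>
    have hK1 : (2 : ℝ) ^ (K + 1) ≤ t := by
      rcases hK with h | h
      · omega
      · exact h
    have ih' := ih (Or.inr (le_trans (pow_le_pow_right₀ (by norm_num) (by omega)) hK1))
    rw [Finset.sum_range_succ]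
    by_cases hc : M ≤ 2 ^ (K + 1)
    · refine (ih' M hM1 hc).trans ?_
      have : 0 ≤ Real.exp 10 * Real.exp (-((((K + 1 : ℕ) : ℝ) * Real.log 2) ^ 3 / (10 ^ 8 * Real.log t ^ 2))) := by
        positivity
      linarith
    · push Not at hc
      have h1 : 1 ≤ 2 ^ (K + 1) := Nat.one_le_two_pow
      rw [← Finset.sum_Ico_consecutive _ h1 hc.le]
      refine (norm_add_le _ _).trans ?_
      have := ih' (2 ^ (K + 1)) h1 le_rfl
      have := block t (K + 1) M (by omega) hK1 hc.le hM
      linarith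

lemma geo (y : ℝ) (hy : 0 < y) (K : ℕ) : ∑ i ∈ Finset.range K, Real.exp (-(y * ((i + 1 : ℕ) : ℝ))) ≤
    (1 - Real.exp (-(y * K))) / y := by
  induction K with
  | zero => simp
  | succ K ih =>
    rw [Finset.sum_range_succ]
    have h1 : Real.exp (-(y * K)) = Real.exp y * Real.exp (-(y * ((K + 1 : ℕ) : ℝ))) := by
      rw [← Real.exp_add]; congr 1; push_cast; ring
    have h2 := Real.add_one_le_exp y
    rw [le_div_iff₀ hy] at ih ⊢
    rw [h1] at ih
    have h3 := Real.exp_pos (-(y * ((K + 1 : ℕ) : ℝ)))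
    nlinarith

lemma sum_bd (L c : ℝ) (hL : 0 < L) (hc : 0 < c) (K : ℕ) :
    ∑ i ∈ Finset.range K, Real.exp (-(c * ((i + 1 : ℕ) : ℝ) ^ 3 / L ^ 2)) ≤
      Real.exp c / c * L ^ ((2 : ℝ) / 3) := by
  set P := L ^ ((2 : ℝ) / 3) with hP
  have hP0 : 0 < P := by positivity
  have hP3 : P ^ 3 = L ^ 2 := by
    rw [hP, ← Real.rpow_natCast, ← Real.rpow_mul hL.le]; norm_num
  have h1 : ∀ i ∈ Finset.range K, Real.exp (-(c * ((i + 1 : ℕ) : ℝ) ^ 3 / L ^ 2)) ≤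
      Real.exp c * Real.exp (-(c / P * ((i + 1 : ℕ) : ℝ))) := by
    intro i _
    rw [← Real.exp_add]
    apply Real.exp_le_exp.2
    set x : ℝ := ((i + 1 : ℕ) : ℝ) / P with hx
    have hx0 : 0 ≤ x := by positivity
    have e1 : c * ((i + 1 : ℕ) : ℝ) ^ 3 / L ^ 2 = c * x ^ 3 := by rw [hx, ← hP3]; field_simp
    have e2 : c / P * ((i + 1 : ℕ) : ℝ) = c * x := by rw [hx]; field_simp
    rw [e1, e2]
    have : x ≤ x ^ 3 + 1 := by nlinarith [sq_nonneg (x - 1), mul_nonneg hx0 (sq_nonneg (x - 1))]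
    nlinarith
  refine (Finset.sum_le_sum h1).trans ?_
  rw [← Finset.mul_sum]
  have h2 := geo (c / P) (by positivity) K
  have h3 : (1 - Real.exp (-(c / P * K))) / (c / P) ≤ 1 / (c / P) := by
    gcongr
    have := Real.exp_pos (-(c / P * K)); linarith
  calc _ ≤ Real.exp c * (1 / (c / P)) := by gcongr; linarith
    _ = _ := by field_simp

lemma log_ge (x : ℝ) (hx : 0 < x) : x - x ^ 2 ≤ Real.log (1 + x) := by
  have := Real.one_sub_inv_le_log_of_pos (x := 1 + x) (by linarith)
  have h2 : x - x ^ 2 ≤ 1 - (1 + x)⁻¹ := by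
    rw [← sub_nonneg]
    have : 1 - (1 + x)⁻¹ - (x - x ^ 2) = x ^ 3 / (1 + x) := by field_simp; ring
    rw [this]; positivity
  linarith

lemma step_err (t : ℝ) (n : ℕ) (ht : 0 < t) (hn : t ≤ n) (hn1 : 1 ≤ n) :
    ‖(ee (t / (2 * Real.pi) * Real.log ((n + 1 : ℕ) : ℝ)) - ee (t / (2 * Real.pi) * Real.log n)) -
      Complex.I * t * ((((n : ℝ)⁻¹ : ℝ) : ℂ) * ee (t / (2 * Real.pi) * Real.log n))‖ ≤ (t ^ 2 + t) * (1 / (n : ℝ) ^ 2) := by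
  have hn0 : (1 : ℝ) ≤ n := by exact_mod_cast hn1
  set x : ℝ := (n : ℝ)⁻¹ with hx
  have hx0 : 0 < x := by rw [hx]; positivity
  set ω := t * Real.log (1 + x) with hω
  have h1 : ee (t / (2 * Real.pi) * Real.log ((n + 1 : ℕ) : ℝ)) =
      ee (t / (2 * Real.pi) * Real.log n) * Complex.exp ((ω : ℂ) * Complex.I) := by
    have : Real.log ((n + 1 : ℕ) : ℝ) = Real.log n + Real.log (1 + x) := by
      rw [← Real.log_mul (by linarith) (by linarith)]; congr 1; rw [hx]; push_cast; field_simp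
    rw [this, mul_add, ee_add]
    congr 1
    unfold ee
    congr 3
    rw [hω]; field_simp
  have hl1 : Real.log (1 + x) ≤ x := by
    have := Real.log_le_sub_one_of_pos (x := 1 + x) (by linarith); linarith
  have hl2 : 0 ≤ Real.log (1 + x) := Real.log_nonneg (by linarith)
  have hl3 := log_ge x hx0
  have hω0 : 0 ≤ ω := by positivity
  have hωx : ω ≤ t * x := by rw [hω]; gcongr
  have htx : t * x ≤ 1 := by rw [hx, ← div_eq_mul_inv, div_le_one (by linarith)]; exact hn
  have hn2 : ‖(ω : ℂ) * Complex.I‖ = ω := by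
    rw [norm_mul, Complex.norm_I, mul_one, Complex.norm_real, Real.norm_eq_abs, abs_of_nonneg hω0]
  have h2 := Complex.norm_exp_sub_one_sub_id_le (x := (ω : ℂ) * Complex.I) (by rw [hn2]; linarith)
  rw [hn2] at h2
  have e : (ee (t / (2 * Real.pi) * Real.log ((n + 1 : ℕ) : ℝ)) - ee (t / (2 * Real.pi) * Real.log n)) -
      Complex.I * t * (((x : ℝ) : ℂ) * ee (t / (2 * Real.pi) * Real.log n)) =
      ee (t / (2 * Real.pi) * Real.log n) * ((Complex.exp ((ω : ℂ) * Complex.I) - 1 - (ω : ℂ) * Complex.I) +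
        ((ω - t * x : ℝ) : ℂ) * Complex.I) := by
    rw [h1]; push_cast; ring
  rw [e, norm_mul, norm_ee, one_mul]
  refine (norm_add_le _ _).trans ?_
  rw [norm_mul, Complex.norm_I, mul_one, Complex.norm_real, Real.norm_eq_abs, abs_of_nonpos (by linarith)]
  have h4 : t * x - ω ≤ t * x ^ 2 := by rw [hω]; nlinarith
  have h5 : ω ^ 2 ≤ (t * x) ^ 2 := by gcongr
  have e3 : 1 / (n : ℝ) ^ 2 = x ^ 2 := by rw [hx]; simp
  rw [e3]
  nlinarith

lemma sq_sum (A M : ℕ) (hA : 1 ≤ A) (h : A ≤ M) : ∑ n ∈ Finset.Ico A M, 1 / (n : ℝ) ^ 2 ≤ 2 / (A : ℝ) - 2 / (M : ℝ) := by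
  induction M, h using Nat.le_induction with
  | base => simp
  | succ M hM ih =>
    rw [Finset.sum_Ico_succ_top hM]
    have hM0 : (1 : ℝ) ≤ M := by exact_mod_cast (by omega : 1 ≤ M)
    have : 1 / (M : ℝ) ^ 2 ≤ 2 / M - 2 / ((M + 1 : ℕ) : ℝ) := by
      push_cast
      rw [← sub_nonneg]
      have e : 2 / (M : ℝ) - 2 / (M + 1) - 1 / (M : ℝ) ^ 2 = (M - 1) / (M ^ 2 * (M + 1)) := by field_simp; ring
      rw [e]
      exact div_nonneg (by linarith) (by positivity)
    linarith

lemma tail (t : ℝ) (A M : ℕ) (ht : 0 < t) (hA1 : 1 ≤ A) (hA : t ≤ A) (h : A ≤ M) :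
    ‖∑ n ∈ Finset.Ico A M, (((n : ℝ)⁻¹ : ℝ) : ℂ) * ee (t / (2 * Real.pi) * Real.log n)‖ ≤ 2 + 4 / t := by
  set S := ∑ n ∈ Finset.Ico A M, (((n : ℝ)⁻¹ : ℝ) : ℂ) * ee (t / (2 * Real.pi) * Real.log n) with hS
  have h1 : ‖(ee (t / (2 * Real.pi) * Real.log M) - ee (t / (2 * Real.pi) * Real.log A)) - Complex.I * t * S‖ ≤
      (t ^ 2 + t) * (2 / t) := by
    rw [← tele (fun n : ℕ => ee (t / (2 * Real.pi) * Real.log n)) A M h, hS, Finset.mul_sum, ← Finset.sum_sub_distrib]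
    refine (norm_sum_le_of_le (n := fun n : ℕ => (t ^ 2 + t) * (1 / (n : ℝ) ^ 2)) _ fun n hn => ?_).trans ?_
    · rw [Finset.mem_Ico] at hn
      have : (A : ℝ) ≤ n := by exact_mod_cast hn.1
      exact step_err t n ht (by linarith) (by omega)
    · rw [← Finset.mul_sum]
      gcongr
      have := sq_sum A M hA1 h
      have h2 : 2 / (A : ℝ) ≤ 2 / t := by gcongr
      have h3 : 0 ≤ 2 / (M : ℝ) := by positivity
      linarith
  have h2 := norm_sub_norm_le (Complex.I * t * S) (ee (t / (2 * Real.pi) * Real.log M) - ee (t / (2 * Real.pi) * Real.log A))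
  rw [norm_sub_rev (Complex.I * t * S) _] at h2
  have h3 := norm_sub_le (ee (t / (2 * Real.pi) * Real.log M)) (ee (t / (2 * Real.pi) * Real.log A))
  rw [norm_ee, norm_ee] at h3
  have h4 : ‖Complex.I * t * S‖ = t * ‖S‖ := by
    rw [norm_mul, norm_mul, Complex.norm_I, one_mul, Complex.norm_real, Real.norm_eq_abs, abs_of_pos ht]
  have h5 : (t ^ 2 + t) * (2 / t) = 2 * t + 2 := by field_simp
  have h6 : t * ‖S‖ ≤ t * (2 + 4 / t) := by
    have : t * (2 + 4 / t) = 2 * t + 4 := by field_simp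
    linarith
  exact le_of_mul_le_mul_left h6 ht

lemma total : ∃ D > (0 : ℝ), ∀ t : ℝ, 0 < t → ∀ M : ℕ, 1 ≤ M →
    ‖∑ n ∈ Finset.Ico 1 M, (((n : ℝ)⁻¹ : ℝ) : ℂ) * ee (t / (2 * Real.pi) * Real.log n)‖ ≤
      3 + 4 / t + D * (Real.log (t + 1)) ^ ((2 : ℝ) / 3) := by
  set c : ℝ := Real.log 2 ^ 3 / 10 ^ 8 with hc
  have hl2 : 0 < Real.log 2 := Real.log_pos (by norm_num)
  have hc0 : 0 < c := by positivity
  refine ⟨Real.exp 10 * (Real.exp c / c), by positivity, fun t ht M hM => ?_⟩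
  have hex : ∃ K : ℕ, t < 2 ^ (K + 1) := by
    obtain ⟨n, hn⟩ := pow_unbounded_of_one_lt t (by norm_num : (1 : ℝ) < 2)
    exact ⟨n, hn.trans_le (pow_le_pow_right₀ (by norm_num) (by omega))⟩
  obtain ⟨K, hK1, hK2⟩ : ∃ K : ℕ, t < 2 ^ (K + 1) ∧ (K = 0 ∨ (2 : ℝ) ^ K ≤ t) := by
    classical
    refine ⟨Nat.find hex, Nat.find_spec hex, ?_⟩
    by_contra hcon
    push Not at hcon
    obtain ⟨ha, hb⟩ := hcon
    exact Nat.find_min hex (m := Nat.find hex - 1) (by omega) (by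
      rw [Nat.sub_add_cancel (by omega)]; exact hb)
  have hlog : 0 < Real.log (t + 1) := Real.log_pos (by linarith)
  have hs : ∑ i ∈ Finset.range K,
        Real.exp 10 * Real.exp (-((((i + 1 : ℕ) : ℝ) * Real.log 2) ^ 3 / (10 ^ 8 * Real.log t ^ 2))) ≤
        Real.exp 10 * (Real.exp c / c) * (Real.log (t + 1)) ^ ((2 : ℝ) / 3) := by
    rw [← Finset.mul_sum, mul_assoc]
    gcongr
    rcases Nat.eq_zero_or_pos K with h0 | h0
    · rw [h0]; simp; positivity
    · have ht2 : (2 : ℝ) ≤ t := by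
        rcases hK2 with h | h
        · omega
        · refine le_trans ?_ h
          calc (2 : ℝ) = 2 ^ 1 := by norm_num
            _ ≤ 2 ^ K := pow_le_pow_right₀ (by norm_num) h0
      refine le_trans (Finset.sum_le_sum fun i _ => ?_) (sum_bd (Real.log (t + 1)) c hlog hc0 K)
      apply Real.exp_le_exp.2
      have hlt : 0 < Real.log t := Real.log_pos (by linarith)
      have hle : Real.log t ≤ Real.log (t + 1) := Real.log_le_log ht (by linarith)
      have e : (((i + 1 : ℕ) : ℝ) * Real.log 2) ^ 3 / (10 ^ 8 * Real.log t ^ 2) =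
          c * ((i + 1 : ℕ) : ℝ) ^ 3 / Real.log t ^ 2 := by rw [hc]; field_simp
      rw [e]
      gcongr
  by_cases hc2 : M ≤ 2 ^ (K + 1)
  · have := head t K hK2 M hM hc2
    have : 0 ≤ 4 / t := by positivity
    linarith
  · push Not at hc2
    have h1 : 1 ≤ 2 ^ (K + 1) := Nat.one_le_two_pow
    rw [← Finset.sum_Ico_consecutive _ h1 hc2.le]
    refine (norm_add_le _ _).trans ?_
    have := head t K hK2 (2 ^ (K + 1)) h1 le_rfl
    have := tail t (2 ^ (K + 1)) M ht h1 (by push_cast; exact hK1.le) hc2.le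
    linarith
end VK


theorem statement9 (σ d θ C1 C2 : ℝ) (hσ : σ ≤ 0) (hd : 0 < d)
    (hC1 : 1 < C1) (hC12 : C1 < C2) :
    ∃ C > (0 : ℝ), ∀ M N : ℕ, 0 < M → 0 < N → C1 * N ≤ M → (M : ℝ) ≤ C2 * N →
      ∀ u : ℝ, 1 ≤ u → u ≤ N →
        ‖∑ m ∈ Finset.Icc 1 M,
            Complex.exp (2 * (Real.pi : ℂ) * Complex.I * ((Fm d θ m u : ℝ) : ℂ)) /
              ((((m : ℝ) ^ (1 - σ) : ℝ)) : ℂ)‖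
          ≤ C * (if σ = 0 then (Real.log (u + 1)) ^ ((2 : ℝ) / 3) else 1) := by
  have hexp : ∀ x : ℝ, Complex.exp (2 * (Real.pi : ℂ) * Complex.I * (x : ℂ)) = VK.ee x := by
    intro x; unfold VK.ee; congr 1; push_cast; ring
  simp_rw [hexp]
  by_cases h0 : σ = 0
  · subst h0
    simp only [if_true, sub_zero, Real.rpow_one]
    obtain ⟨D, hD, hT⟩ := VK.total
    have hpi := Real.pi_pos
    have hl2 : 0 < Real.log 2 := Real.log_pos (by norm_num)
    set G := Real.log (1 + 2 * Real.pi * d) / Real.log 2 + 1 with hG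
    have hG0 : 0 < G := by
      have : 0 < Real.log (1 + 2 * Real.pi * d) := Real.log_pos (by
        have : 0 < 2 * Real.pi * d := by positivity
        linarith)
      positivity
    refine ⟨(3 + 4 / (2 * Real.pi * d)) / (Real.log 2) ^ ((2 : ℝ) / 3) + D * G ^ ((2 : ℝ) / 3), by positivity, ?_⟩
    intro M N hM hN _ _ u hu _
    set t := 2 * Real.pi * (d * u) with ht
    have hu0 : 0 < u := by linarith
    have ht0 : 0 < t := by positivity
    have hTM := hT t ht0 (M + 1) (by omega)
    have hlu : Real.log 2 ≤ Real.log (u + 1) := Real.log_le_log (by norm_num) (by linarith)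
    have e : ∑ m ∈ Finset.Icc 1 M, VK.ee (Fm d θ m u) / ((m : ℝ) : ℂ) =
        VK.ee (d * u * (1 - Real.log (d * u)) + θ * u) *
        ∑ n ∈ Finset.Ico 1 (M + 1), (((n : ℝ)⁻¹ : ℝ) : ℂ) * VK.ee (t / (2 * Real.pi) * Real.log n) := by
      rw [Finset.mul_sum]
      refine Finset.sum_congr (by ext; simp only [Finset.mem_Icc, Finset.mem_Ico]; omega) fun m hm => ?_
      have hm1 : 1 ≤ m := by rw [Finset.mem_Ico] at hm; exact hm.1
      have hm0 : (0 : ℝ) < m := by exact_mod_cast hm1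
      have hF : Fm d θ m u = (d * u * (1 - Real.log (d * u)) + θ * u) + t / (2 * Real.pi) * Real.log m := by
        unfold Fm
        rw [Real.log_div (by positivity) (by positivity), Real.log_mul (by positivity) (by positivity), Real.log_exp, ht,
          mul_div_cancel_left₀ _ (by positivity)]
        ring
      rw [hF, VK.ee_add, div_eq_mul_inv, Complex.ofReal_inv]
      ring
    rw [e, norm_mul, VK.norm_ee, one_mul]
    refine hTM.trans ?_
    have hlt : Real.log (t + 1) ≤ G * Real.log (u + 1) := by
      have h1 : t + 1 ≤ (1 + 2 * Real.pi * d) * (u + 1) := by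
        have : 0 < 2 * Real.pi * d := by positivity
        rw [ht]; nlinarith
      have hq : 0 < 1 + 2 * Real.pi * d := by positivity
      have h2 := Real.log_le_log (by linarith) h1
      rw [Real.log_mul hq.ne' (by linarith)] at h2
      have h3 : Real.log (1 + 2 * Real.pi * d) ≤ Real.log (1 + 2 * Real.pi * d) / Real.log 2 * Real.log (u + 1) := by
        have : 0 ≤ Real.log (1 + 2 * Real.pi * d) / Real.log 2 := by
          apply div_nonneg (Real.log_nonneg _) hl2.le
          have : 0 < 2 * Real.pi * d := by positivity
          linarith
        calc _ = Real.log (1 + 2 * Real.pi * d) / Real.log 2 * Real.log 2 := by field_simp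
          _ ≤ _ := by gcongr
      rw [hG]; linarith
    have hlu0 : 0 ≤ Real.log (u + 1) := by linarith
    have hlt0 : 0 ≤ Real.log (t + 1) := Real.log_nonneg (by linarith)
    have h4 : Real.log (t + 1) ^ ((2 : ℝ) / 3) ≤ G ^ ((2 : ℝ) / 3) * Real.log (u + 1) ^ ((2 : ℝ) / 3) := by
      rw [← Real.mul_rpow hG0.le hlu0]
      exact Real.rpow_le_rpow hlt0 hlt (by norm_num)
    have h5 : Real.log 2 ^ ((2 : ℝ) / 3) ≤ Real.log (u + 1) ^ ((2 : ℝ) / 3) :=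
      Real.rpow_le_rpow hl2.le hlu (by norm_num)
    have h6 : 4 / t ≤ 4 / (2 * Real.pi * d) := by
      gcongr
      rw [ht, ← mul_assoc]
      exact le_mul_of_one_le_right (by positivity) hu
    have h7 : 3 + 4 / (2 * Real.pi * d) ≤ (3 + 4 / (2 * Real.pi * d)) / (Real.log 2) ^ ((2 : ℝ) / 3) *
        Real.log (u + 1) ^ ((2 : ℝ) / 3) := by
      rw [div_mul_eq_mul_div, le_div_iff₀ (by positivity)]
      gcongr
    have h8 : D * Real.log (t + 1) ^ ((2 : ℝ) / 3) ≤ D * (G ^ ((2 : ℝ) / 3) * Real.log (u + 1) ^ ((2 : ℝ) / 3)) := by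
      gcongr
    linarith
  · have hs : σ < 0 := lt_of_le_of_ne hσ h0
    have hsum : Summable (fun n : ℕ => 1 / (n : ℝ) ^ (1 - σ)) :=
      Real.summable_one_div_nat_rpow.2 (by linarith)
    have hnn : 0 ≤ ∑' n : ℕ, 1 / (n : ℝ) ^ (1 - σ) := tsum_nonneg fun n => by positivity
    refine ⟨∑' n : ℕ, 1 / (n : ℝ) ^ (1 - σ) + 1, by linarith, ?_⟩
    intro M N _ _ _ _ u _ _
    rw [if_neg h0, mul_one]
    refine (norm_sum_le_of_le (n := fun n : ℕ => 1 / (n : ℝ) ^ (1 - σ)) _ fun m _ => ?_).trans ?_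
    · rw [norm_div, VK.norm_ee, Complex.norm_real, Real.norm_eq_abs, abs_of_nonneg (by positivity)]
    · have := hsum.sum_le_tsum (Finset.Icc 1 M) (fun n _ => by positivity)
      linarith
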